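/- (Riemann Hypothesis of Wan–Poonen–Sheats, polynomial case.) Let k be a positive integer and let Z_k(X) = Σ_{d≥0} S_d(k) X^d ∈ K[X] be the zeta polynomial (a polynomial since S_d(k) = 0 for d large). Then in an algebraic closure of K, equipped with the unique extension of the ∞-adic absolute value of K, any two roots of Z_k having the same absolute value are equal, and moreover every root of Z_k is a simple root; that is, each zero of ζ_A(x,-k) is uniquely determined by its absolute value, including multiplicity. -/

import Mathlib

/-- `K = F_q((1/θ))`, realized as the field of formal Laurent series over `F_q`
in the variable `t = 1/θ`. -/
abbrev Kinfty (Fq : Type) [Field Fq] := LaurentSeries Fq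

/-- The element `θ = t⁻¹` of `K = F_q((1/θ))`. -/
noncomputable def theta (Fq : Type) [Field Fq] : Kinfty Fq := HahnSeries.single (-1) 1

/-- The embedding `A = F_q[θ] → K = F_q((1/θ))` sending `θ` to `t⁻¹`. -/
noncomputable def AtoK (Fq : Type) [Field Fq] : Polynomial Fq →+* Kinfty Fq :=
  Polynomial.eval₂RingHom (algebraMap Fq (Kinfty Fq)) (theta Fq)

/-- The power sum `S_d(k) = Σ a^k`, `a` ranging over monic polynomials of degree `d`. -/
noncomputable def powerSum (Fq : Type) [Field Fq] [Fintype Fq] (d k : ℕ) : Polynomial Fq :=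
  ∑ᶠ a ∈ {a : Polynomial Fq | a.Monic ∧ a.natDegree = d}, a ^ k

/-- The ∞-adic absolute value on `K = F_q((1/θ))`, normalized so that `|a| = q^{deg a}`
for `a ∈ A`, i.e. `|x| = q^{-v_∞(x)}` with `v_∞(1/θ) = 1`. -/
noncomputable def absKinfty (Fq : Type) [Field Fq] [Fintype Fq] (x : Kinfty Fq) : ℝ :=
  open scoped Classical in
  if x = 0 then 0 else (Fintype.card Fq : ℝ) ^ (-(HahnSeries.order x))

namespace WPS
open Finset

/-- Digit data: base `p`, digits `kd t` for `t < L`, residue classes modulo `m`. -/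
structure Dat (m : ℕ) where
  p : ℤ
  kd : ℕ → ℤ
  L : ℕ
  hp : 2 ≤ p
  h0 : ∀ t, 0 ≤ kd t
  h1 : ∀ t, kd t ≤ p - 1

section Comb
set_option linter.unusedSectionVars false
variable {m : ℕ} [NeZero m] (D : Dat m)

theorem cyc {P : ZMod m → Prop} (j0 : ZMod m) (h0 : P j0) (h : ∀ j, P (j-1) → P j) :
    ∀ j, P j := by
  have key : ∀ n : ℕ, P (j0 + n) := by
    intro n
    induction n with
    | zero => simpa using h0
    | succ n ih =>
      apply h
      have : j0 + ((n+1 : ℕ) : ZMod m) - 1 = j0 + n := by push_cast; ring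
      rw [this]; exact ih
  intro j
  have := key (j - j0).val
  rw [ZMod.natCast_zmod_val] at this
  simpa using this

theorem cyc' {P : ZMod m → Prop} (j0 : ZMod m) (h0 : P j0) (h : ∀ j, P j → P (j-1)) :
    ∀ j, P j := by
  intro j
  have := cyc (P := fun i => P (-i)) (-j0) (by simpa using h0) (by
    intro i hi
    have := h _ hi
    have e : -(i-1) - 1 = -i := by ring
    rwa [e] at this) (-j)
  simpa using this

/-- the count vector attached to a carry vector -/
def Dat.n (a : ZMod m → ℤ) (j : ZMod m) : ℤ := D.p * a j - a (j-1)

/-- number of class `j` elements at positions below `T` -/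
def Dat.cum (T : ℕ) (j : ZMod m) : ℤ := ∑ t ∈ range T, if (t : ZMod m) = j then D.kd t else 0

def Dat.dg (t : ℕ) (x : ℤ) : ℤ := max 0 (min (x - D.cum t (t : ZMod m)) (D.kd t))

def Dat.dv (a : ZMod m → ℤ) (t : ℕ) : ℤ := D.dg t (D.n a (t : ZMod m))

def Dat.F (a : ZMod m → ℤ) : ℤ := ∑ t ∈ range D.L, D.p ^ t * D.dv a t

def Dat.Ok (a : ZMod m → ℤ) : Prop := ∀ j, 0 ≤ D.n a j ∧ D.n a j ≤ D.cum D.L j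

theorem Dat.dg_nonneg (t x) : 0 ≤ D.dg t x := le_max_left _ _
theorem Dat.dg_le (t x) : D.dg t x ≤ D.kd t := max_le (D.h0 t) (min_le_right _ _)
theorem Dat.dg_mono (t) {x y : ℤ} (h : x ≤ y) : D.dg t x ≤ D.dg t y := by
  unfold Dat.dg
  exact max_le_max le_rfl (min_le_min (by omega) le_rfl)
theorem Dat.cum_mono {S T : ℕ} (h : S ≤ T) (j) : D.cum S j ≤ D.cum T j := by
  unfold Dat.cum
  apply Finset.sum_le_sum_of_subset_of_nonneg
  · simpa using h
  · intro i _ _; split_ifs; exacts [D.h0 _, le_rfl]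
theorem Dat.cum_nonneg (T j) : 0 ≤ D.cum T j := by
  have := D.cum_mono (Nat.zero_le T) j
  simpa [Dat.cum] using this

theorem Dat.cum_succ_self (t : ℕ) : D.cum (t+1) (t : ZMod m) = D.cum t (t : ZMod m) + D.kd t := by
  unfold Dat.cum; rw [Finset.sum_range_succ]; simp

theorem Dat.sum_dg (T : ℕ) (j : ZMod m) (x : ℤ) (hx : 0 ≤ x) :
    ∑ t ∈ range T, (if (t : ZMod m) = j then D.dg t x else 0) = min x (D.cum T j) := by
  induction T with
  | zero => simp [Dat.cum, hx]
  | succ T ih =>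
    rw [Finset.sum_range_succ, ih]
    by_cases h : (T : ZMod m) = j
    · subst h
      rw [D.cum_succ_self]
      have := D.h0 T
      simp only [if_true, Dat.dg]
      omega
    · have : D.cum (T+1) j = D.cum T j := by
        unfold Dat.cum; rw [Finset.sum_range_succ]; simp [h]
      simp [h, this]

theorem Dat.sum_dg_full (j : ZMod m) (x : ℤ) (hx : 0 ≤ x) (hx' : x ≤ D.cum D.L j) :
    ∑ t ∈ range D.L, (if (t : ZMod m) = j then D.dg t x else 0) = x := by
  rw [D.sum_dg _ _ _ hx, min_eq_left hx']

theorem Dat.dg_prefix {t t' : ℕ} (h : t < t') (hc : (t : ZMod m) = (t' : ZMod m)) {x : ℤ}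
    (hx : 0 < D.dg t' x) : D.dg t x = D.kd t := by
  have h1 := D.cum_mono (Nat.succ_le_of_lt h) (t : ZMod m)
  rw [Nat.succ_eq_add_one, D.cum_succ_self, hc] at h1
  have := D.h0 t
  unfold Dat.dg at *
  rw [hc]
  omega

theorem Dat.n_add (a b : ZMod m → ℤ) (j) : D.n (a + b) j = D.n a j + D.n b j := by
  simp [Dat.n]; ring
theorem Dat.n_sub (a b : ZMod m → ℤ) (j) : D.n (a - b) j = D.n a j - D.n b j := by
  simp [Dat.n]; ring

theorem Dat.nonneg_of_n {a : ZMod m → ℤ} (h : ∀ j, 0 ≤ D.n a j) (j) : 0 ≤ a j := by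
  obtain ⟨i, hi⟩ := Finite.exists_min a
  have h1 := h i
  have h2 := hi (i-1)
  have h3 := hi j
  unfold Dat.n at h1
  have := D.hp
  nlinarith

theorem Dat.pos_of_n {a : ZMod m → ℤ} (h : ∀ j, 0 ≤ D.n a j) (hne : a ≠ 0) (j) : 1 ≤ a j := by
  have h0 := D.nonneg_of_n h
  by_contra hlt
  apply hne
  have hj : a j = 0 := by have := h0 j; omega
  funext i
  refine cyc' (P := fun i => a i = 0) j hj ?_ i
  intro i hi
  have h1 := h i
  have h2 := h0 (i-1)
  unfold Dat.n at h1
  rw [hi] at h1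
  linarith

theorem Dat.lt_of_n {a b : ZMod m → ℤ} (h : ∀ j, D.n a j ≤ D.n b j) (hne : a ≠ b) (j) :
    a j + 1 ≤ b j := by
  have := D.pos_of_n (a := b - a) (fun j => by rw [D.n_sub]; linarith [h j])
    (by intro h; exact hne (by rw [sub_eq_zero] at h; exact h.symm)) j
  simp at this; linarith

theorem Dat.n_inj {a b : ZMod m → ℤ} (h : ∀ j, D.n a j = D.n b j) : a = b := by
  by_contra hne
  have h1 := D.lt_of_n (fun j => (h j).le) hne 0
  have h2 := D.lt_of_n (fun j => (h j).ge) (Ne.symm hne) 0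
  omega

theorem sum_lt_pow {p : ℤ} (hp : 2 ≤ p) (f : ℕ → ℤ) (hf : ∀ t, f t ≤ p - 1)
    (T : ℕ) : ∑ t ∈ range T, p ^ t * f t ≤ p ^ T - 1 := by
  induction T with
  | zero => simp
  | succ T ih =>
    rw [Finset.sum_range_succ, pow_succ]
    have : 0 < p ^ T := by positivity
    nlinarith [hf T]

theorem seq_lt {p : ℤ} (hp : 2 ≤ p) (f g : ℕ → ℤ) (hf1 : ∀ t, f t ≤ p - 1)
    (hg0 : ∀ t, 0 ≤ g t) {T L : ℕ} (hT : T < L) (hlt : f T < g T)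
    (hle : ∀ t, T < t → t < L → f t ≤ g t) :
    ∑ t ∈ range L, p ^ t * f t < ∑ t ∈ range L, p ^ t * g t := by
  induction L with
  | zero => omega
  | succ L ih =>
    rw [Finset.sum_range_succ, Finset.sum_range_succ]
    have hpos : 0 < p ^ L := by positivity
    by_cases h : T = L
    · subst h
      have h1 := sum_lt_pow hp f hf1 T
      have h2 : 0 ≤ ∑ t ∈ range T, p ^ t * g t :=
        Finset.sum_nonneg (fun t _ => mul_nonneg (by positivity) (hg0 t))
      nlinarith
    · have h1 := ih (by omega) (fun t h1 h2 => hle t h1 (by omega))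
      have h2 := hle L (by omega) (by omega)
      nlinarith

theorem top_pos (P : ℕ → Prop) (L : ℕ) :
    (∀ t, t < L → ¬ P t) ∨ ∃ T, T < L ∧ P T ∧ ∀ t, T < t → t < L → ¬ P t := by
  induction L with
  | zero => left; intro t h; omega
  | succ L ih =>
    by_cases h : P L
    · right; exact ⟨L, by omega, h, fun t h1 h2 => by omega⟩
    · rcases ih with ih | ⟨T, h1, h2, h3⟩
      · left; intro t ht
        rcases Nat.lt_succ_iff_lt_or_eq.mp ht with h' | rfl
        exacts [ih t h', h]
      · right; refine ⟨T, by omega, h2, fun t h4 h5 => ?_⟩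
        rcases Nat.lt_succ_iff_lt_or_eq.mp h5 with h' | rfl
        exacts [h3 t h4 h', h]

theorem Dat.dv_nonneg (a t) : 0 ≤ D.dv a t := D.dg_nonneg _ _
theorem Dat.dv_le (a t) : D.dv a t ≤ D.p - 1 := (D.dg_le _ _).trans (D.h1 t)
theorem Dat.dv_mono {a b : ZMod m → ℤ} (h : ∀ j, D.n a j ≤ D.n b j) (t) : D.dv a t ≤ D.dv b t :=
  D.dg_mono _ (h _)
theorem Dat.F_mono {a b : ZMod m → ℤ} (h : ∀ j, D.n a j ≤ D.n b j) : D.F a ≤ D.F b := by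
  apply Finset.sum_le_sum; intro t _
  exact mul_le_mul_of_nonneg_left (D.dv_mono h t) (by have := D.hp; positivity)

theorem Dat.F_lt {a b : ZMod m → ℤ} {T : ℕ} (hT : T < D.L) (h : D.dv a T < D.dv b T)
    (h' : ∀ t, T < t → t < D.L → D.dv a t ≤ D.dv b t) : D.F a < D.F b :=
  seq_lt D.hp _ _ (D.dv_le a) (D.dv_nonneg b) hT h h'

theorem Dat.sum_dv {a : ZMod m → ℤ} (ha : D.Ok a) (j : ZMod m) :
    ∑ t ∈ range D.L, (if (t : ZMod m) = j then D.dv a t else 0) = D.n a j := by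
  conv_rhs => rw [← D.sum_dg_full j _ (ha j).1 (ha j).2]
  apply Finset.sum_congr rfl; intro t _
  split_ifs with h
  · rw [Dat.dv, h]
  · rfl

theorem Dat.eq_of_dv {a b : ZMod m → ℤ} (ha : D.Ok a) (hb : D.Ok b)
    (h : ∀ t, t < D.L → D.dv a t = D.dv b t) : a = b := by
  apply D.n_inj; intro j
  rw [← D.sum_dv ha, ← D.sum_dv hb]
  apply Finset.sum_congr rfl; intro t ht
  rw [h t (by simpa using ht)]

theorem Dat.F_inj {a b : ZMod m → ℤ} (ha : D.Ok a) (hb : D.Ok b) (h : D.F a = D.F b) : a = b := by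
  rcases top_pos (fun t => D.dv a t ≠ D.dv b t) D.L with h1 | ⟨T, h1, h2, h3⟩
  · exact D.eq_of_dv ha hb (fun t ht => by simpa using h1 t ht)
  · exfalso
    simp only [ne_eq, not_not] at h3
    rcases lt_or_gt_of_ne h2 with h4 | h4
    · exact (D.F_lt h1 h4 (fun t h5 h6 => (h3 t h5 h6).le)).ne h
    · exact (D.F_lt h1 h4 (fun t h5 h6 => (h3 t h5 h6).ge)).ne h.symm

/-- minimality of the prefix representation -/
theorem Dat.F_min {a : ZMod m → ℤ} (ha : D.Ok a) (w : ℕ → ℤ) (h0 : ∀ t, t < D.L → 0 ≤ w t)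
    (h1 : ∀ t, t < D.L → w t ≤ D.kd t)
    (hs : ∀ j : ZMod m, ∑ t ∈ range D.L, (if (t : ZMod m) = j then w t else 0) = D.n a j) :
    D.F a ≤ ∑ t ∈ range D.L, D.p ^ t * w t := by
  have split : ∀ f : ℕ → ℤ, ∑ t ∈ range D.L, f t =
      ∑ j : ZMod m, ∑ t ∈ range D.L, if (t : ZMod m) = j then f t else 0 := by
    intro f; rw [Finset.sum_comm]; simp
  unfold Dat.F
  rw [split, split (fun t => D.p ^ t * w t)]
  apply Finset.sum_le_sum; intro j _
  have hz : ∑ t ∈ range D.L, (if (t : ZMod m) = j then w t - D.dv a t else 0) = 0 := by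
    have := hs j
    rw [← D.sum_dv ha j, ← sub_eq_zero, ← Finset.sum_sub_distrib] at this
    refine Eq.trans (Finset.sum_congr rfl ?_) this; intro t _; split_ifs <;> simp
  rw [← sub_nonneg, ← Finset.sum_sub_distrib]
  have hex : ∃ c : ℤ, ∀ t, t < D.L → (t : ZMod m) = j →
      0 ≤ (w t - D.dv a t) * (D.p ^ t - c) := by
    by_cases hf : ∃ t, t < D.L ∧ (t : ZMod m) = j ∧ D.dv a t < D.kd t
    · classical
      have hsp := Nat.find_spec hf
      have hmin := fun t => Nat.find_min hf (m := t)
      set T := Nat.find hf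
      refine ⟨D.p ^ T, fun t ht hj => ?_⟩
      have hp1 : 1 ≤ D.p := by linarith [D.hp]
      rcases lt_trichotomy t T with h | h | h
      · have : D.kd t ≤ D.dv a t := by
          by_contra hc; exact hmin t h ⟨ht, hj, by omega⟩
        have h2 : D.p ^ t ≤ D.p ^ T := pow_le_pow_right₀ hp1 h.le
        exact mul_nonneg_of_nonpos_of_nonpos (by linarith [h1 t ht]) (by linarith)
      · rw [h]; simp
      · have : D.dv a t = 0 := by
          by_contra hc
          have hpos : 0 < D.dv a t := lt_of_le_of_ne (D.dv_nonneg a t) (Ne.symm hc)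
          have hcl : (T : ZMod m) = (t : ZMod m) := by rw [hsp.2.1, hj]
          have := D.dg_prefix h hcl hpos
          rw [← hcl] at this
          exact hsp.2.2.ne this
        have h2 : D.p ^ T ≤ D.p ^ t := pow_le_pow_right₀ hp1 h.le
        rw [this]
        exact mul_nonneg (by linarith [h0 t ht]) (by linarith)
    · push Not at hf
      refine ⟨D.p ^ D.L, fun t ht hj => ?_⟩
      have h2 : D.p ^ t ≤ D.p ^ D.L := pow_le_pow_right₀ (by linarith [D.hp]) ht.le
      exact mul_nonneg_of_nonpos_of_nonpos (by linarith [h1 t ht, hf t ht hj]) (by linarith)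
  obtain ⟨c, hc⟩ := hex
  have : ∑ t ∈ range D.L, ((if (t : ZMod m) = j then D.p ^ t * w t else 0) -
      (if (t : ZMod m) = j then D.p ^ t * D.dv a t else 0)) =
      ∑ t ∈ range D.L, (if (t : ZMod m) = j then (w t - D.dv a t) * (D.p ^ t - c) else 0) +
      c * ∑ t ∈ range D.L, (if (t : ZMod m) = j then w t - D.dv a t else 0) := by
    rw [Finset.mul_sum, ← Finset.sum_add_distrib]
    apply Finset.sum_congr rfl; intro t _; split_ifs <;> ring
  rw [this, hz, mul_zero, add_zero]
  apply Finset.sum_nonneg; intro t ht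
  split_ifs with h
  · exact hc t (by simpa using ht) h
  · exact le_rfl

/-- betweenness: `x` lies between `0` and `y`. -/
def Btw (x y : ℤ) : Prop := (0 ≤ x ∧ x ≤ y) ∨ (y ≤ x ∧ x ≤ 0)

theorem Dat.ok_exch {a b η : ZMod m → ℤ} (ha : D.Ok a) (hb : D.Ok b)
    (h : ∀ j, Btw (D.n η j) (D.n (b - a) j)) : D.Ok (a + η) ∧ D.Ok (b - η) := by
  constructor <;> intro j <;>
  · have h1 := ha j
    have h2 := hb j
    have h3 := h j
    unfold Btw at h3
    simp only [D.n_sub, D.n_add] at *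
    omega

theorem Dat.exch {a b η : ZMod m → ℤ} (ha : D.Ok a) (hb : D.Ok b)
    (h : ∀ j, Btw (D.n η j) (D.n (b - a) j)) :
    D.F (a + η) + D.F (b - η) ≤ D.F a + D.F b := by
  obtain ⟨o1, o2⟩ := D.ok_exch ha hb h
  have hbt : ∀ t, (D.dv a t ≤ D.dv (a+η) t ∧ D.dv (a+η) t ≤ D.dv b t) ∨
      (D.dv b t ≤ D.dv (a+η) t ∧ D.dv (a+η) t ≤ D.dv a t) := by
    intro t
    unfold Dat.dv
    have h3 := h t
    unfold Btw at h3
    simp only [D.n_sub, D.n_add] at *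
    rcases h3 with h3 | h3
    · left; exact ⟨D.dg_mono _ (by omega), D.dg_mono _ (by omega)⟩
    · right; exact ⟨D.dg_mono _ (by omega), D.dg_mono _ (by omega)⟩
  have := D.F_min o2 (fun t => D.dv a t + D.dv b t - D.dv (a+η) t) ?_ ?_ ?_
  · have e : ∑ t ∈ range D.L, D.p ^ t * (D.dv a t + D.dv b t - D.dv (a+η) t) =
      D.F a + D.F b - D.F (a + η) := by
      unfold Dat.F
      rw [← Finset.sum_add_distrib, ← Finset.sum_sub_distrib]
      apply Finset.sum_congr rfl; intro t _; ring
    linarith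
  · intro t _
    have := D.dv_nonneg a t
    have := D.dv_nonneg b t
    rcases hbt t with h | h <;> omega
  · intro t _
    have h1 : D.dv a t ≤ D.kd t := D.dg_le _ _
    have h2 : D.dv b t ≤ D.kd t := D.dg_le _ _
    rcases hbt t with h | h <;> omega
  · intro j
    have e : ∀ t : ℕ, (if (t : ZMod m) = j then D.dv a t + D.dv b t - D.dv (a+η) t else 0) =
       (if (t : ZMod m) = j then D.dv a t else 0) + (if (t : ZMod m) = j then D.dv b t else 0)
       - (if (t : ZMod m) = j then D.dv (a+η) t else 0) := by
      intro t; split_ifs <;> simp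
    simp only [e]
    rw [Finset.sum_sub_distrib, Finset.sum_add_distrib, D.sum_dv ha, D.sum_dv hb, D.sum_dv o1,
      D.n_sub, D.n_add]
    ring

def vmin (a b : ZMod m → ℤ) : ZMod m → ℤ := fun j => min (a j) (b j)
def vmax (a b : ZMod m → ℤ) : ZMod m → ℤ := fun j => max (a j) (b j)

theorem Dat.lattice {a b : ZMod m → ℤ} (ha : D.Ok a) (hb : D.Ok b) :
    D.Ok (vmax a b) ∧ D.Ok (vmin a b) ∧ D.F (vmax a b) + D.F (vmin a b) ≤ D.F a + D.F b := by
  have e1 : vmax a b = a + (fun j => max 0 (b j - a j)) := by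
    funext j; simp [vmax]; omega
  have e2 : vmin a b = b - (fun j => max 0 (b j - a j)) := by
    funext j; simp [vmin]; omega
  have hB : ∀ j, Btw (D.n (fun j => max 0 (b j - a j)) j) (D.n (b - a) j) := by
    intro j
    unfold Btw Dat.n
    simp only [Pi.sub_apply]
    have hp := D.hp
    generalize b j - a j = x
    generalize b (j-1) - a (j-1) = y
    rcases le_total 0 x with hx | hx <;> rcases le_total 0 y with hy | hy
    · rw [max_eq_right hx, max_eq_right hy]; omega
    · rw [max_eq_right hx, max_eq_left hy]
      left; constructor <;> nlinarith
    · rw [max_eq_left hx, max_eq_right hy]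
      right; constructor <;> nlinarith
    · rw [max_eq_left hx, max_eq_left hy]
      have : D.p * x ≤ 0 := by nlinarith
      simp; omega
  rw [e1, e2]
  exact ⟨(D.ok_exch ha hb hB).1, (D.ok_exch ha hb hB).2, D.exch ha hb hB⟩

/-- tight solutions below a supersolution -/
theorem tight (p : ℤ) (hp : 0 ≤ p) (lo R σ : ZMod m → ℤ) (h1 : ∀ j, lo j ≤ σ j)
    (h2 : ∀ j, p * σ j - R j ≤ σ (j-1)) :
    ∃ x : ZMod m → ℤ, (∀ j, lo j ≤ x j) ∧ (∀ j, x j ≤ σ j) ∧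
      ∀ j, x (j-1) = max (lo (j-1)) (p * x j - R j) := by
  classical
  let N := fun x : ZMod m → ℤ => (∑ j, (x j - lo j)).toNat
  let S : Set (ZMod m → ℤ) := {x | (∀ j, lo j ≤ x j) ∧ (∀ j, x j ≤ σ j) ∧
      ∀ j, p * x j - R j ≤ x (j-1)}
  have hS : S.Nonempty := ⟨σ, h1, fun _ => le_rfl, h2⟩
  obtain ⟨x, ⟨hx1, hx2, hx3⟩, hmin⟩ : ∃ x ∈ S, ∀ y ∈ S, N x ≤ N y := by
    have := (InvImage.wf N Nat.lt_wfRel.wf).has_min S hS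
    obtain ⟨x, hx, h⟩ := this
    exact ⟨x, hx, fun y hy => not_lt.mp (h y hy)⟩
  refine ⟨x, hx1, hx2, fun j => ?_⟩
  by_contra hne
  have hgt : max (lo (j-1)) (p * x j - R j) + 1 ≤ x (j-1) := by
    have := hx1 (j-1); have := hx3 j; omega
  have hy : Function.update x (j-1) (x (j-1) - 1) ∈ S := by
    have hle : ∀ i, Function.update x (j-1) (x (j-1) - 1) i ≤ x i := by
      intro i; by_cases h : i = j-1
      · subst h; simp
      · simp [h]
    refine ⟨fun i => ?_, fun i => (hle i).trans (hx2 i), fun i => ?_⟩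
    · by_cases h : i = j-1
      · subst h; simp; omega
      · simp [h, hx1]
    · have h5 : p * Function.update x (j-1) (x (j-1) - 1) i ≤ p * x i :=
        mul_le_mul_of_nonneg_left (hle i) hp
      by_cases h : i = j
      · subst h; rw [Function.update_self]; omega
      · have : i - 1 ≠ j - 1 := fun h' => h (by simpa using h')
        rw [Function.update_of_ne this]
        have := hx3 i; omega
  have := hmin _ hy
  have hsum : ∑ i, (Function.update x (j-1) (x (j-1) - 1) i - lo i) = ∑ i, (x i - lo i) - 1 := by
    rw [← Finset.add_sum_erase _ _ (Finset.mem_univ (j-1)),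
      ← Finset.add_sum_erase _ (fun i => x i - lo i) (Finset.mem_univ (j-1))]
    have : ∑ i ∈ univ.erase (j-1), (Function.update x (j-1) (x (j-1) - 1) i - lo i) =
      ∑ i ∈ univ.erase (j-1), (x i - lo i) := by
      apply Finset.sum_congr rfl; intro i hi
      rw [Function.update_of_ne (Finset.ne_of_mem_erase hi)]
    rw [this]; simp; ring
  have hpos : 0 < ∑ i, (x i - lo i) := by
    apply Finset.sum_pos'
    · intro i _; linarith [hx1 i]
    · exact ⟨j-1, Finset.mem_univ _, by omega⟩
  simp only [N, hsum] at this
  omega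

/-- the exchange vector -/
theorem Dat.exists_eta {a b σ : ZMod m → ℤ} (h0 : ∀ j, 0 ≤ σ j) (i : ZMod m)
    (hi : D.n (b - a) i < 0) (hi' : 1 ≤ σ (i-1))
    (h1 : ∀ j, 0 ≤ D.n (b - a) j → D.p * σ j - D.n (b - a) j ≤ σ (j-1))
    (h2 : ∀ j, D.n (b - a) j < 0 → D.p * σ j ≤ σ (j-1)) :
    ∃ η : ZMod m → ℤ, (∀ j, 0 ≤ η j) ∧ (∀ j, η j ≤ σ j) ∧ η ≠ 0 ∧
      ∀ j, Btw (D.n η j) (D.n (b - a) j) := by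
  classical
  have hp := D.hp
  obtain ⟨η, e1, e2, e3⟩ := tight D.p (by linarith) (fun j => if j = i - 1 then 1 else 0)
    (fun j => max 0 (D.n (b-a) j)) σ (by
      intro j; by_cases h : j = i-1
      · subst h; simpa using hi'
      · simpa [h] using h0 j) (by
      intro j
      rcases le_or_gt 0 (D.n (b-a) j) with h | h
      · rw [max_eq_right h]; exact h1 j h
      · rw [max_eq_left h.le, sub_zero]; exact h2 j h)
  have hη0 : ∀ j, 0 ≤ η j := fun j => le_trans (by split_ifs <;> simp) (e1 j)
  refine ⟨η, hη0, e2, ?_, ?_⟩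
  · rintro rfl
    have := e1 (i-1); simp at this
  · intro j
    have e := e3 j
    unfold Btw
    have hq : 0 ≤ D.p * η j := mul_nonneg (by linarith) (hη0 j)
    have hn : D.n η j = D.p * η j - η (j-1) := rfl
    rw [hn]
    by_cases hj : j - 1 = i - 1
    · have hji : j = i := by simpa using hj
      subst hji
      simp only [if_true] at e
      omega
    · simp only [hj, if_false] at e
      omega
end Comb
end WPS

namespace WPS
open Finset
section Comb2
set_option linter.unusedSectionVars false
variable {m : ℕ} [NeZero m] (D : Dat m)

def Dat.Chain (d : ℕ) (c : ℕ → ZMod m → ℤ) : Prop :=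
  c 0 = 0 ∧ (∀ s, s < d → ∀ j, c s j + 1 ≤ c (s+1) j) ∧ ∀ s, s ≤ d → D.Ok (c s)

def Dat.cost (d : ℕ) (c : ℕ → ZMod m → ℤ) : ℤ := ∑ s ∈ range d, D.F (c (s+1))

theorem Dat.F_nonneg (a) : 0 ≤ D.F a :=
  Finset.sum_nonneg (fun t _ => mul_nonneg (by have := D.hp; positivity) (D.dv_nonneg a t))

theorem Dat.n_zero (j) : D.n 0 j = 0 := by simp [Dat.n]

theorem Dat.ok_zero : D.Ok 0 := fun j => by
  rw [D.n_zero]; exact ⟨le_rfl, D.cum_nonneg _ _⟩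

theorem Dat.dv_zero (t) : D.dv 0 t = 0 := by
  have := D.cum_nonneg t (t : ZMod m)
  unfold Dat.dv Dat.dg; rw [D.n_zero]; omega

theorem Dat.F_zero : D.F 0 = 0 := by
  unfold Dat.F; simp [D.dv_zero]

theorem Dat.Chain.ge {D : Dat m} {d c} (h : D.Chain d c) {s : ℕ} (hs : s ≤ d) (j) :
    (s : ℤ) ≤ c s j := by
  induction s with
  | zero => rw [h.1]; simp
  | succ s ih =>
    have := ih (by omega)
    have := h.2.1 s (by omega) j
    push_cast; omega

theorem Dat.exists_argmin (P : (ZMod m → ℤ) → Prop) (h : ∃ x, P x) :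
    ∃ x, P x ∧ ∀ y, P y → D.F x ≤ D.F y := by
  obtain ⟨x, hx, hm⟩ := (InvImage.wf (fun x => (D.F x).toNat) Nat.lt_wfRel.wf).has_min
    {x | P x} h
  refine ⟨x, hx, fun y hy => ?_⟩
  have h1 : ¬ (D.F y).toNat < (D.F x).toNat := hm y hy
  have := D.F_nonneg x
  have := D.F_nonneg y
  omega

/-- descending one level -/
theorem Dat.descend {a : ZMod m → ℤ} (ha : D.Ok a) (s : ℕ) (h : ∀ j, (s : ℤ) + 1 ≤ a j) :
    ∃ x, D.Ok x ∧ (∀ j, (s : ℤ) ≤ x j) ∧ ∀ j, x j + 1 ≤ a j := by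
  have hp := D.hp
  obtain ⟨x, e1, e2, e3⟩ := tight D.p (by linarith) (fun _ => (s : ℤ)) (D.n a) (fun j => a j - 1)
    (fun j => by have := h j; omega) (fun j => by unfold Dat.n; linarith)
  refine ⟨x, fun j => ?_, e1, fun j => by have := e2 j; omega⟩
  have h1 := ha j
  have h2 := e3 j
  have h3 : (s : ℤ) ≤ D.p * x j := by nlinarith [e1 j]
  have hn : D.n x j = D.p * x j - x (j-1) := rfl
  omega

def Dat.Greedy (d : ℕ) (u : ℕ → ZMod m → ℤ) : Prop :=
  D.Chain d u ∧ ∀ s, 0 < s → s ≤ d → ∀ x, D.Ok x → (∀ j, (s : ℤ) ≤ x j) →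
    (s < d → ∀ j, x j + 1 ≤ u (s+1) j) → D.F (u s) ≤ D.F x

theorem Dat.exists_greedyQ (d : ℕ) : ∀ (Q : (ZMod m → ℤ) → Prop),
    (∃ x, D.Ok x ∧ (∀ j, (d : ℤ) ≤ x j) ∧ Q x) →
    ∃ u, D.Chain d u ∧ (0 < d → Q (u d)) ∧
    ∀ s, 0 < s → s ≤ d → ∀ x, D.Ok x → (∀ j, (s : ℤ) ≤ x j) →
    (s < d → ∀ j, x j + 1 ≤ u (s+1) j) → (s = d → Q x) → D.F (u s) ≤ D.F x := by
  induction d with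
  | zero =>
    intro Q _
    refine ⟨fun _ => 0, ⟨rfl, by intro s hs; omega, fun s _ => D.ok_zero⟩, by simp, ?_⟩
    intro s h1 h2; omega
  | succ d ih =>
    intro Q hQ
    obtain ⟨A, ⟨hA1, hA2, hA3⟩, hA4⟩ := D.exists_argmin _ hQ
    push_cast at hA2
    obtain ⟨u, hu1, hu2, hu3⟩ := ih (fun x => ∀ j, x j + 1 ≤ A j) (D.descend hA1 d hA2)
    refine ⟨fun s => if s = d + 1 then A else u s, ⟨?_, ?_, ?_⟩, ?_, ?_⟩
    · simp [hu1.1]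
    · intro s hs j
      have h1 : s ≠ d + 1 := by omega
      rcases Nat.lt_succ_iff_lt_or_eq.mp hs with h | h
      · have h2 : s ≠ d := by omega
        simp [h1, h2, hu1.2.1 s h j]
      · subst h
        simp only [h1, if_true, if_false]
        rcases Nat.eq_zero_or_pos s with h | h
        · subst h; rw [hu1.1]; have := hA2 j; simpa using this
        · exact hu2 h j
    · intro s hs
      by_cases h : s = d + 1
      · simp [h, hA1]
      · simp only [h, if_false]; exact hu1.2.2 s (by omega)
    · intro _; simpa using hA3
    · intro s h1 h2 x h3 h4 h5 h6
      by_cases h : s = d + 1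
      · subst h
        simp only [if_true]
        exact hA4 x ⟨h3, h4, h6 rfl⟩
      · simp only [h, if_false]
        apply hu3 s h1 (by omega) x h3 h4
        · intro h7 j
          have := h5 (by omega) j
          have h8 : s ≠ d := by omega
          simpa [h8] using this
        · rintro rfl j
          have := h5 (by omega) j
          simpa using this

theorem Dat.exists_greedy {d c} (h : D.Chain d c) : ∃ u, D.Greedy d u := by
  obtain ⟨u, h1, -, h3⟩ := D.exists_greedyQ d (fun _ => True)
    ⟨c d, h.2.2 d le_rfl, fun j => h.ge le_rfl j, trivial⟩
  exact ⟨u, h1, fun s a b x e f g => h3 s a b x e f g (fun _ => trivial)⟩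

/-- an exchange between a minimiser pair is impossible -/
theorem Dat.no_exch {a b η : ZMod m → ℤ} (ha : D.Ok a) (hb : D.Ok b) (hη : η ≠ 0)
    (h : ∀ j, Btw (D.n η j) (D.n (b - a) j)) (h1 : D.F a ≤ D.F (a + η))
    (h2 : D.F b ≤ D.F (b - η)) : False := by
  have := D.exch ha hb h
  have e : D.F a = D.F (a + η) := by linarith
  have := D.F_inj ha (D.ok_exch ha hb h).1 e
  exact hη (by simpa using this)

theorem Dat.Greedy.nested {D : Dat m} {d u} (hu : D.Greedy d u) {s : ℕ} (hs : s < d) (j) :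
    D.n (u s) j ≤ D.n (u (s+1)) j := by
  have hp := D.hp
  rcases Nat.eq_zero_or_pos s with h0 | h0
  · subst h0; rw [hu.1.1, D.n_zero]; exact (hu.1.2.2 _ hs j).1
  by_contra hlt
  have hlink := hu.1.2.1 s hs
  have hn : ∀ j, D.n (u (s+1) - u s) j = D.p * (u (s+1) j - u s j) - (u (s+1) (j-1) - u s (j-1)) :=
    fun j => rfl
  obtain ⟨η, e1, e2, e3, e4⟩ := D.exists_eta (a := u s) (b := u (s+1))
    (σ := fun j => u (s+1) j - u s j - 1) (fun j => by have := hlink j; omega) j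
    (by rw [D.n_sub]; omega)
    (by have h1 : D.n (u (s+1) - u s) j < 0 := by rw [D.n_sub]; omega
        rw [hn] at h1; have := hlink j; nlinarith)
    (fun i hi => by rw [hn]; linarith)
    (fun i hi => by rw [hn] at hi; have := hlink i; nlinarith)
  refine D.no_exch (hu.1.2.2 s hs.le) (hu.1.2.2 _ hs) e3 e4 ?_ ?_
  · apply hu.2 s h0 hs.le _ (D.ok_exch (hu.1.2.2 s hs.le) (hu.1.2.2 _ hs) e4).1
    · intro i; have := hu.1.ge hs.le i; have := e1 i; simp; omega
    · intro _ i; have := e2 i; simp; omega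
  · apply hu.2 (s+1) (by omega) hs _ (D.ok_exch (hu.1.2.2 s hs.le) (hu.1.2.2 _ hs) e4).2
    · intro i; have := hu.1.ge hs.le i; have := e2 i; simp; omega
    · intro h i; have := e1 i; have := hu.1.2.1 (s+1) h i; simp; omega

/-- interleaved and locally optimal -/
structure Dat.Loc (d : ℕ) (u v : ℕ → ZMod m → ℤ) : Prop where
  hu : D.Greedy d u
  hv : D.Chain d v
  up : ∀ s, s < d → ∀ j, v s j ≤ u (s+1) j
  loc : ∀ s, s < d → ∀ x, D.Ok x → (∀ j, v s j + 1 ≤ x j) →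
    (s + 1 < d → ∀ j, x j + 1 ≤ v (s+2) j ∧ x j ≤ u (s+2) j) → D.F (v (s+1)) ≤ D.F x

variable {D}
theorem Dat.Loc.ge {d u v} (h : D.Loc d u v) : ∀ e s, s + e = d → ∀ j, u s j ≤ v s j := by
  intro e
  induction e with
  | zero =>
    intro s hs
    rcases Nat.eq_zero_or_pos s with h0 | h0
    · subst h0; rw [h.hu.1.1, h.hv.1]; simp
    obtain ⟨s, rfl⟩ : ∃ s', s = s' + 1 := ⟨s-1, by omega⟩
    have o1 := h.hu.1.2.2 (s+1) (by omega)
    have o2 := h.hv.2.2 (s+1) (by omega)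
    obtain ⟨l1, l2, l3⟩ := D.lattice o1 o2
    have f1 : D.F (u (s+1)) ≤ D.F (vmin (u (s+1)) (v (s+1))) := by
      apply h.hu.2 _ h0 (by omega) _ l2
      · intro j; have := h.hu.1.ge (s := s+1) (by omega) j
        have := h.hv.ge (s := s+1) (by omega) j
        unfold vmin; omega
      · intro h; omega
    have f2 : D.F (v (s+1)) ≤ D.F (vmax (u (s+1)) (v (s+1))) := by
      apply h.loc s (by omega) _ l1
      · intro j; have := h.hv.2.1 s (by omega) j; unfold vmax; omega
      · intro h; omega
    have := D.F_inj l1 o2 (by linarith)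
    intro j
    rw [← this]; unfold vmax; exact le_max_left _ _
  | succ e ih =>
    intro s hs
    have ih := ih (s+1) (by omega)
    rcases Nat.eq_zero_or_pos s with h0 | h0
    · subst h0; rw [h.hu.1.1, h.hv.1]; simp
    obtain ⟨s, rfl⟩ : ∃ s', s = s' + 1 := ⟨s-1, by omega⟩
    have o1 := h.hu.1.2.2 (s+1) (by omega)
    have o2 := h.hv.2.2 (s+1) (by omega)
    obtain ⟨l1, l2, l3⟩ := D.lattice o1 o2
    have hlu := h.hu.1.2.1 (s+1) (by omega)
    have hlv := h.hv.2.1 (s+1) (by omega)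
    have f1 : D.F (u (s+1)) ≤ D.F (vmin (u (s+1)) (v (s+1))) := by
      apply h.hu.2 _ h0 (by omega) _ l2
      · intro j; have := h.hu.1.ge (s := s+1) (by omega) j
        have := h.hv.ge (s := s+1) (by omega) j
        unfold vmin; omega
      · intro h j; have := hlu j; unfold vmin; omega
    have f2 : D.F (v (s+1)) ≤ D.F (vmax (u (s+1)) (v (s+1))) := by
      apply h.loc s (by omega) _ l1
      · intro j; have := h.hv.2.1 s (by omega) j; unfold vmax; omega
      · intro h' j
        have h1 := hlu j; have h2 := hlv j; have h3 := ih j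
        have h4 := h.up (s+1) (by omega) j
        have e : s + 1 + 1 = s + 2 := rfl
        rw [e] at *
        unfold vmax; omega
    have := D.F_inj l1 o2 (by linarith)
    intro j
    rw [← this]; unfold vmax; exact le_max_left _ _

theorem Dat.Loc.ge' {d u v} (h : D.Loc d u v) {s} (hs : s ≤ d) (j) : u s j ≤ v s j :=
  h.ge (d - s) s (by omega) j

theorem Dat.Loc.star {d u v} (h : D.Loc d u v) {s} (hs : s ≤ d) (j) :
    v s (j-1) - u s (j-1) ≤ D.p * (v s j - u s j) + (D.p - 1) := by
  have hp := D.hp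
  rcases Nat.eq_zero_or_pos s with h0 | h0
  · subst h0; rw [h.hu.1.1, h.hv.1]; simp; omega
  obtain ⟨s, rfl⟩ : ∃ s', s = s' + 1 := ⟨s-1, by omega⟩
  by_contra hlt
  have o1 := h.hu.1.2.2 (s+1) (by omega)
  have o2 := h.hv.2.2 (s+1) (by omega)
  have hge := fun j => h.ge' hs j
  have hn : ∀ j, D.n (v (s+1) - u (s+1)) j =
    D.p * (v (s+1) j - u (s+1) j) - (v (s+1) (j-1) - u (s+1) (j-1)) := fun j => rfl
  obtain ⟨η, e1, e2, e3, e4⟩ := D.exists_eta (a := u (s+1)) (b := v (s+1))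
    (σ := fun j => max 0 (v (s+1) j - u (s+1) j - 1)) (fun j => le_max_left _ _) j
    (by rw [hn]; omega)
    (by have := hge j; have : 0 ≤ D.p * (v (s+1) j - u (s+1) j) := by nlinarith
        omega)
    (fun i hi => by
      rw [hn] at hi ⊢
      have h1 := hge i
      have h2 := hge (i-1)
      rcases h1.eq_or_lt with h1 | h1
      · rw [h1] at hi ⊢; simp at hi ⊢; omega
      · rw [max_eq_right (by omega : 0 ≤ v (s+1) i - u (s+1) i - 1)]
        have : D.p * (v (s+1) i - u (s+1) i - 1) = D.p * (v (s+1) i - u (s+1) i) - D.p := by ring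
        omega)
    (fun i hi => by
      rw [hn] at hi
      have h1 := hge i
      have h2 := hge (i-1)
      rcases h1.eq_or_lt with h1 | h1
      · rw [h1] at hi ⊢; simp
      · rw [max_eq_right (by omega : 0 ≤ v (s+1) i - u (s+1) i - 1)]
        have : D.p * (v (s+1) i - u (s+1) i - 1) = D.p * (v (s+1) i - u (s+1) i) - D.p := by ring
        omega)
  obtain ⟨k1, k2⟩ := D.ok_exch o1 o2 e4
  refine D.no_exch o1 o2 e3 e4 ?_ ?_
  · apply h.hu.2 (s+1) h0 hs _ k1
    · intro i; have := h.hu.1.ge hs i; have := e1 i; simp only [Pi.add_apply]; omega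
    · intro h' i
      have h1 := e2 i
      have h2 := h.hu.1.2.1 (s+1) h' i
      have h3 := h.up (s+1) h' i
      simp only [Pi.add_apply]; omega
  · apply h.loc s (by omega) _ k2
    · intro i; have h1 := e2 i
      have h2 := h.hv.2.1 s (by omega) i
      have h3 := h.up s (by omega) i
      simp only [Pi.sub_apply]; omega
    · intro h' i
      have h1 := e1 i
      have h2 := h.hv.2.1 (s+1) h' i
      have h3 := h.up (s+1) h' i
      have e : s + 1 + 1 = s + 2 := rfl
      rw [e] at *
      simp only [Pi.sub_apply]; omega

theorem Dat.Loc.dlem {d u v} (h : D.Loc d u v) {s} (hs : s < d) (j) :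
    D.n (u s) j ≤ D.n (v (s+1)) j := by
  have hp := D.hp
  rcases Nat.eq_zero_or_pos s with h0 | h0
  · subst h0; rw [h.hu.1.1, D.n_zero]; exact (h.hv.2.2 _ hs j).1
  by_contra hlt
  have o1 := h.hu.1.2.2 s hs.le
  have o2 := h.hv.2.2 (s+1) hs
  have lu := h.hu.1.2.1 s hs
  have lv := h.hv.2.1 s hs
  have s1 := fun j => h.star hs.le j
  have s2 := fun j => h.star (s := s+1) hs j
  have g1 := fun j => h.ge' hs.le j
  have g2 := fun j => h.ge' (s := s+1) hs j
  have hn : ∀ j, D.n (v (s+1) - u s) j =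
    D.p * (v (s+1) j - u s j) - (v (s+1) (j-1) - u s (j-1)) := fun j => rfl
  -- the vector e
  obtain ⟨e, he⟩ : ∃ e : ZMod m → ℤ, ∀ j, e j = max (v s j - u s j) (v (s+1) j - u (s+1) j) :=
    ⟨_, fun j => rfl⟩
  have hes : ∀ j, e (j-1) + 1 ≤ D.p * e j + D.p := by
    intro j
    have h1 := s1 j
    have h2 := s2 j
    have h3 : D.p * (v s j - u s j) ≤ D.p * e j :=
      mul_le_mul_of_nonneg_left (by rw [he]; exact le_max_left _ _) (by linarith)
    have h4 : D.p * (v (s+1) j - u (s+1) j) ≤ D.p * e j :=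
      mul_le_mul_of_nonneg_left (by rw [he]; exact le_max_right _ _) (by linarith)
    rw [he (j-1)]; omega
  have hσ0 : ∀ j, 0 ≤ v (s+1) j - u s j - e j - 1 := by
    intro j; rw [he]; have := lu j; have := lv j; omega
  have hmul : ∀ j, D.p * (v (s+1) j - u s j - e j - 1) =
    D.p * (v (s+1) j - u s j) - D.p * e j - D.p := fun j => by ring
  obtain ⟨η, e1, e2, e3, e4⟩ := D.exists_eta (a := u s) (b := v (s+1))
    (σ := fun j => v (s+1) j - u s j - e j - 1) hσ0 j
    (by rw [D.n_sub]; omega)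
    (by have h1 : D.n (v (s+1) - u s) j < 0 := by rw [D.n_sub]; omega
        rw [hn] at h1
        have h2 := hes j
        have h3 := hmul j
        have h4 : 0 ≤ D.p * (v (s+1) j - u s j - e j - 1) := mul_nonneg (by linarith) (hσ0 j)
        omega)
    (fun i hi => by
      rw [hn] at hi ⊢
      have h2 := hes i
      have h3 := hmul i
      omega)
    (fun i hi => by
      rw [hn] at hi
      have h2 := hes i
      have h3 := hmul i
      omega)
  obtain ⟨k1, k2⟩ := D.ok_exch o1 o2 e4
  refine D.no_exch o1 o2 e3 e4 ?_ ?_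
  · apply h.hu.2 s h0 hs.le _ k1
    · intro i; have := h.hu.1.ge hs.le i; have := e1 i; simp only [Pi.add_apply]; omega
    · intro h' i
      have h1 := e2 i
      have h2 := he i
      simp only [Pi.add_apply]; omega
  · apply h.loc s hs _ k2
    · intro i; have h1 := e2 i
      have h2 := he i
      simp only [Pi.sub_apply]; omega
    · intro h' i
      have h1 := e1 i
      have h2 := h.hv.2.1 (s+1) h' i
      have h3 := h.up (s+1) h' i
      have e : s + 1 + 1 = s + 2 := rfl
      rw [e] at *
      simp only [Pi.sub_apply]; omega
end Comb2
end WPS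

namespace WPS
open Finset
section Comb3
set_option linter.unusedSectionVars false
variable {m : ℕ} [NeZero m] {D : Dat m}

theorem Dat.dv_prefix {a : ZMod m → ℤ} {t t' : ℕ} (h : t < t') (hc : (t : ZMod m) = (t' : ZMod m))
    (hx : 0 < D.dv a t') : D.dv a t = D.kd t := by
  unfold Dat.dv at *
  rw [hc]
  exact D.dg_prefix h hc hx

theorem Dat.Loc.starstar {d u v} (h : D.Loc d u v) {s} (hs0 : 0 < s) (hs : s ≤ d) {T t0 : ℕ}
    (hag : ∀ t, T < t → t < D.L → D.dv (u s) t = D.dv (v s) t) (ht0 : T < t0) (ht0' : t0 < D.L)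
    (hpos : 0 < D.dv (u s) t0) :
    v s ((t0 : ZMod m) - 1) = u s ((t0 : ZMod m) - 1) := by
  classical
  have hp := D.hp
  have o1 := h.hu.1.2.2 s hs
  have o2 := h.hv.2.2 s hs
  have hge := fun j => h.ge' hs j
  obtain ⟨j, hj⟩ : ∃ j : ZMod m, j = (t0 : ZMod m) := ⟨_, rfl⟩
  rw [← hj]
  have hpos' : 0 < D.dv (v s) t0 := by rw [← hag t0 ht0 ht0']; exact hpos
  have hneq : D.n (u s) j = D.n (v s) j := by
    rw [← D.sum_dv o1, ← D.sum_dv o2]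
    apply Finset.sum_congr rfl; intro t ht
    split_ifs with hc
    · rcases lt_or_ge t t0 with hlt | hle
      · rw [D.dv_prefix hlt (hc.trans hj) hpos, D.dv_prefix hlt (hc.trans hj) hpos']
      · exact hag t (by omega) (by simpa using ht)
    · rfl
  have hδ : v s (j-1) - u s (j-1) = D.p * (v s j - u s j) := by
    unfold Dat.n at hneq; linarith
  by_contra hne
  have hδj : 1 ≤ v s j - u s j := by
    have h1 := hge j
    by_contra hc
    have : v s j - u s j = 0 := by omega
    rw [this] at hδ
    exact hne (by omega)
  have hnpos : 1 ≤ D.n (u s) j := by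
    have := D.cum_nonneg t0 (t0 : ZMod m)
    unfold Dat.dv Dat.dg at hpos
    rw [← hj] at hpos this
    omega
  obtain ⟨x, e1, e2, e3⟩ := tight D.p (by linarith) (fun _ => (s : ℤ))
    (fun i => if i = j then D.n (u s) j - 1 else max (D.n (u s) i) (D.n (v s) i))
    (fun i => max (u s i) (v s i - 1))
    (fun i => (h.hu.1.ge hs i).trans (le_max_left _ _))
    (fun i => by
      by_cases hi : i = j
      · subst hi
        rw [if_pos rfl, max_eq_right (by omega), hneq]
        have : D.p * (v s i - 1) - (D.n (v s) i - 1) = v s (i-1) - D.p + 1 := by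
          unfold Dat.n; ring
        rw [this]
        exact le_trans (by omega) (le_max_right _ _)
      · rw [if_neg hi]
        rcases le_total (u s i) (v s i - 1) with h1 | h1
        · rw [max_eq_right h1]
          refine le_trans ?_ (le_max_right _ _)
          have : D.p * (v s i - 1) - D.n (v s) i = v s (i-1) - D.p := by
            unfold Dat.n; ring
          have := le_max_right (D.n (u s) i) (D.n (v s) i)
          omega
        · rw [max_eq_left h1]
          refine le_trans ?_ (le_max_left _ _)
          have : D.p * (u s i) - D.n (u s) i = u s (i-1) := by
            unfold Dat.n; ring
          have := le_max_left (D.n (u s) i) (D.n (v s) i)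
          omega)
  have hps : ∀ i, (s : ℤ) ≤ D.p * x i := fun i => by nlinarith [e1 i]
  have hnx : ∀ i, D.n x i = D.p * x i - x (i-1) := fun _ => rfl
  have okx : D.Ok x := by
    intro i
    have h1 := e3 i
    have h2 := hps i
    have h3 := o1 i
    have h4 := o2 i
    have h5 := hnx i
    by_cases hi : i = j
    · subst hi
      rw [if_pos rfl] at h1
      omega
    · rw [if_neg hi] at h1
      omega
  have hxj : D.n x j ≤ D.n (u s) j - 1 := by
    have h1 := e3 j
    rw [if_pos rfl] at h1
    have := hnx j
    omega
  have hle : ∀ t, T < t → t < D.L → D.dv x t ≤ D.dv (u s) t := by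
    intro t ht1 ht2
    by_cases hi : (t : ZMod m) = j
    · unfold Dat.dv; apply D.dg_mono; rw [hi]; omega
    · have h1 := e3 (t : ZMod m)
      rw [if_neg hi] at h1
      have h2 := hnx (t : ZMod m)
      have h3 : D.n x t ≤ max (D.n (u s) t) (D.n (v s) t) := by omega
      rcases le_total (D.n (u s) t) (D.n (v s) t) with h4 | h4
      · rw [max_eq_right h4] at h3
        rw [hag t ht1 ht2]; exact D.dg_mono _ h3
      · rw [max_eq_left h4] at h3
        exact D.dg_mono _ h3
  have hlt : ∃ t, T < t ∧ t < D.L ∧ D.dv x t < D.dv (u s) t := by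
    by_contra hc
    push Not at hc
    have hx0 : 0 < D.dv x t0 := lt_of_lt_of_le hpos (hc t0 ht0 ht0')
    have : D.n (u s) j ≤ D.n x j := by
      rw [← D.sum_dv o1, ← D.sum_dv okx]
      apply Finset.sum_le_sum; intro t ht
      split_ifs with hcl
      · rcases lt_or_ge t t0 with hlt | hle'
        · rw [D.dv_prefix hlt (hcl.trans hj) hpos, D.dv_prefix hlt (hcl.trans hj) hx0]
        · exact hc t (by omega) (by simpa using ht)
      · exact le_rfl
    omega
  obtain ⟨t, q1, q2, q3⟩ := hlt
  have hF := D.F_lt q2 q3 (fun t' h1 h2 => hle t' (by omega) h2)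
  have := h.hu.2 s hs0 hs x okx e1 (fun h' i => by
    have h1 := e2 i
    have h2 := h.hu.1.2.1 s h' i
    have h3 := h.up s h' i
    omega)
  omega

theorem Dat.dg_max_cum {T t : ℕ} (h : T ≤ t) (x : ℤ) :
    D.dg t (max x (D.cum T (t : ZMod m))) = D.dg t x := by
  have := D.cum_mono h (t : ZMod m)
  have := D.h0 t
  unfold Dat.dg
  omega

theorem Dat.Loc.noloss {d u v} (h : D.Loc d u v) {T : ℕ} (hT : T < D.L)
    (hag : ∀ s, s ≤ d → ∀ t, T < t → t < D.L → D.dv (u s) t = D.dv (v s) t) {s} (hs0 : 0 < s)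
    (hs : s ≤ d) : D.dv (u s) T ≤ D.dv (v s) T := by
  classical
  have hp := D.hp
  by_contra hloss
  push Not at hloss
  have o1 := h.hu.1.2.2 s hs
  have o2 := h.hv.2.2 s hs
  rcases hs.eq_or_lt with hsd | hsd
  · have := h.hu.2 s hs0 hs (v s) o2 (fun j => h.hv.ge hs j) (fun h => by omega)
    have h2 := D.F_lt hT hloss (fun t h1 h2 => (hag s hs t h1 h2).ge)
    omega
  obtain ⟨x, e1, e2, e3⟩ := tight D.p (by linarith) (fun _ => (s : ℤ))
    (fun i => max (D.n (v s) i) (D.cum T i)) (v s) (fun i => h.hv.ge hs i)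
    (fun i => by
      have : D.p * (v s i) - D.n (v s) i = v s (i-1) := by unfold Dat.n; ring
      have := le_max_left (D.n (v s) i) (D.cum T i)
      omega)
  have hps : ∀ i, (s : ℤ) ≤ D.p * x i := fun i => by nlinarith [e1 i]
  have hnx : ∀ i, D.n x i = D.p * x i - x (i-1) := fun _ => rfl
  have hxle : ∀ i, D.n x i ≤ max (D.n (v s) i) (D.cum T i) := by
    intro i; have := hnx i; have := e3 i; omega
  have okx : D.Ok x := by
    intro i
    have h1 := e3 i
    have h2 := hps i
    have h4 := o2 i
    have h5 := hnx i
    have h6 := D.cum_mono hT.le i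
    omega
  have hdx : ∀ t, T ≤ t → D.dv x t ≤ D.dv (v s) t := by
    intro t ht
    have := D.dg_mono t (hxle (t : ZMod m))
    rw [D.dg_max_cum ht] at this
    exact this
  have hF : D.F x < D.F (u s) := D.F_lt hT (lt_of_le_of_lt (hdx T le_rfl) hloss)
    (fun t h1 h2 => by rw [hag s hs t h1 h2]; exact hdx t h1.le)
  have hlu := h.hu.1.2.1 s hsd
  have hlv := h.hv.2.1 s hsd
  have hup := h.up s hsd
  obtain ⟨j0, hj0⟩ : ∃ j, x j = u (s+1) j := by
    by_contra hc
    push Not at hc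
    have := h.hu.2 s hs0 hs x okx e1 (fun _ i => by
      have := hc i; have := e2 i; have := hup i; omega)
    omega
  have hall : ∀ j, x j = u (s+1) j := by
    refine cyc j0 hj0 ?_
    intro j hj
    by_contra hne
    have hlt : x j < u (s+1) j := by have := e2 j; have := hup j; omega
    have h1 := e3 j
    have h2 := h.hu.1.ge (s := s+1) hsd (j-1)
    push_cast at h2
    have hA : D.n (u (s+1)) j = D.p * u (s+1) j - u (s+1) (j-1) := rfl
    have h3 : D.p * x j + D.p ≤ D.p * u (s+1) j := by nlinarith
    have h4 : D.cum T j + D.p ≤ D.n (u (s+1)) j := by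
      have := le_max_right (D.n (v s) j) (D.cum T j)
      omega
    -- an element above T
    obtain ⟨t0, q1, q2, q3, q4⟩ : ∃ t0, T < t0 ∧ t0 < D.L ∧ (t0 : ZMod m) = j ∧
        0 < D.dv (u (s+1)) t0 := by
      by_contra hc
      push Not at hc
      have hsum := D.sum_dv (h.hu.1.2.2 (s+1) hsd) j
      have hb : ∑ t ∈ range D.L, (if (t : ZMod m) = j then D.dv (u (s+1)) t else 0) ≤
          ∑ t ∈ range D.L, (if t < T + 1 then (if (t : ZMod m) = j then D.kd t else 0) else 0) := by
        apply Finset.sum_le_sum; intro t ht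
        by_cases hcl : (t : ZMod m) = j
        · by_cases htT : t < T + 1
          · simp only [hcl, htT, if_true]; exact D.dg_le _ _
          · simp only [hcl, htT, if_true, if_false]
            exact hc t (by omega) (by simpa using ht) hcl
        · simp [hcl]
      have hfil : ∑ t ∈ range D.L, (if t < T + 1 then (if (t : ZMod m) = j then D.kd t else 0) else 0)
          = D.cum (T+1) j := by
        unfold Dat.cum
        rw [← Finset.sum_filter]
        apply Finset.sum_congr _ (fun _ _ => rfl)
        ext t; simp; omega
      have hcs : D.cum (T+1) j ≤ D.cum T j + (D.p - 1) := by
        unfold Dat.cum; rw [Finset.sum_range_succ]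
        have := D.h1 T
        split_ifs <;> omega
      omega
    have := h.starstar (s := s+1) (by omega) hsd (hag (s+1) hsd) q1 q2 q4
    rw [q3] at this
    have h5 := e2 (j-1)
    have h6 := hlv (j-1)
    omega
  have hxu : x = u (s+1) := funext hall
  have := D.F_mono (fun j => h.hu.nested hsd j)
  rw [hxu] at hF
  omega

/-- split of a digit sum at position T -/
theorem Dat.F_split (a : ZMod m → ℤ) {T : ℕ} (hT : T < D.L) :
    D.F a = ∑ t ∈ range T, D.p ^ t * D.dv a t + D.p ^ T * D.dv a T +
      ∑ t ∈ Ico (T+1) D.L, D.p ^ t * D.dv a t := by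
  unfold Dat.F
  rw [← Finset.sum_range_succ, Finset.sum_range_add_sum_Ico _ (by omega : T + 1 ≤ D.L)]

theorem Dat.Loc.cost_lt {d u v} (h : D.Loc d u v) (hle : D.cost d v ≤ D.cost d u) :
    ∀ s, s ≤ d → v s = u s := by
  have hp := D.hp
  rcases top_pos (fun t => ∃ s, s ≤ d ∧ D.dv (u s) t ≠ D.dv (v s) t) D.L with h1 | ⟨T, h1, h2, h3⟩
  · intro s hs
    refine (D.eq_of_dv (h.hu.1.2.2 s hs) (h.hv.2.2 s hs) (fun t ht => ?_)).symm
    by_contra hc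
    exact h1 t ht ⟨s, hs, hc⟩
  exfalso
  have hag : ∀ s, s ≤ d → ∀ t, T < t → t < D.L → D.dv (u s) t = D.dv (v s) t := by
    intro s hs t ht1 ht2
    by_contra hc
    exact h3 t ht1 ht2 ⟨s, hs, hc⟩
  obtain ⟨s1, hs1, hs1'⟩ := h2
  have hs10 : s1 ≠ 0 := by
    rintro rfl
    rw [h.hu.1.1, h.hv.1] at hs1'; exact hs1' rfl
  obtain ⟨s0, rfl⟩ : ∃ s', s1 = s' + 1 := ⟨s1-1, by omega⟩
  have hno : ∀ s, s < d → D.dv (u (s+1)) T ≤ D.dv (v (s+1)) T := fun s hs =>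
    h.noloss h1 hag (by omega) hs
  have hsumT : ∑ s ∈ range d, D.dv (u (s+1)) T + 1 ≤ ∑ s ∈ range d, D.dv (v (s+1)) T := by
    have : ∑ s ∈ range d, D.dv (u (s+1)) T < ∑ s ∈ range d, D.dv (v (s+1)) T := by
      apply Finset.sum_lt_sum
      · intro s hs; exact hno s (by simpa using hs)
      · exact ⟨s0, by simpa using hs1, lt_of_le_of_ne (hno s0 hs1) hs1'⟩
    omega
  let G := fun a : ZMod m → ℤ => ∑ t ∈ range T, D.p ^ t * D.dv a t
  let H := fun a : ZMod m → ℤ => ∑ t ∈ Ico (T+1) D.L, D.p ^ t * D.dv a t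
  have hG0 : ∀ a, 0 ≤ G a := fun a =>
    Finset.sum_nonneg (fun t _ => mul_nonneg (by positivity) (D.dv_nonneg a t))
  have hGT : ∀ a, G a ≤ D.p ^ T - 1 := fun a => sum_lt_pow hp _ (D.dv_le a) T
  have hGsum : ∑ s ∈ range d, G (u (s+1)) ≤ ∑ s ∈ range d, G (v (s+1)) + (D.p ^ T - 1) := by
    obtain ⟨e, rfl⟩ : ∃ e, d = e + 1 := ⟨d-1, by omega⟩
    rw [Finset.sum_range_succ, Finset.sum_range_succ' (fun s => G (v (s+1)))]
    have : ∑ s ∈ range e, G (u (s+1)) ≤ ∑ s ∈ range e, G (v (s+1+1)) := by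
      apply Finset.sum_le_sum; intro s hs
      apply Finset.sum_le_sum; intro t _
      apply mul_le_mul_of_nonneg_left _ (by positivity)
      exact D.dv_mono (fun j => h.dlem (s := s+1) (by have := Finset.mem_range.mp hs; omega) j) t
    have := hG0 (v (0+1))
    have := hGT (u (e+1))
    linarith
  have hH : ∀ s ∈ range d, H (u (s+1)) = H (v (s+1)) := by
    intro s hs
    apply Finset.sum_congr rfl; intro t ht
    have := Finset.mem_Ico.mp ht
    rw [hag (s+1) (by simpa using hs) t (by omega) this.2]
  have hcost : ∀ w : ℕ → ZMod m → ℤ, D.cost d w = ∑ s ∈ range d, G (w (s+1)) +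
      D.p ^ T * ∑ s ∈ range d, D.dv (w (s+1)) T + ∑ s ∈ range d, H (w (s+1)) := by
    intro w
    unfold Dat.cost
    rw [Finset.mul_sum, ← Finset.sum_add_distrib, ← Finset.sum_add_distrib]
    apply Finset.sum_congr rfl; intro s _
    exact D.F_split _ h1
  rw [hcost, hcost, Finset.sum_congr rfl hH] at hle
  have hpT : 0 < D.p ^ T := by positivity
  nlinarith

variable (D)
/-- the uncrossing inequality -/
theorem Dat.uncross {d : ℕ} {a c : ℕ → ZMod m → ℤ} (ha : ∀ s, s ≤ d → D.Ok (a s))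
    (hc : ∀ s, s ≤ d → D.Ok (c s)) :
    ∑ s ∈ range d, D.F (vmax (a (s+1)) (c s)) + ∑ s ∈ range d, D.F (vmin (a (s+1)) (c s)) ≤
    ∑ s ∈ range d, D.F (a (s+1)) + ∑ s ∈ range d, D.F (c s) := by
  rw [← Finset.sum_add_distrib, ← Finset.sum_add_distrib]
  apply Finset.sum_le_sum; intro s hs
  have := Finset.mem_range.mp hs
  exact (D.lattice (ha (s+1) this) (hc s (by omega))).2.2

theorem Dat.cost_eq (d : ℕ) {c : ℕ → ZMod m → ℤ} (h : c 0 = 0) :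
    D.cost d c = ∑ s ∈ range d, D.F (c s) + D.F (c d) := by
  rw [← Finset.sum_range_succ, Finset.sum_range_succ', h, D.F_zero, add_zero]; rfl

theorem Dat.cost_nonneg (d c) : 0 ≤ D.cost d c := Finset.sum_nonneg (fun _ _ => D.F_nonneg _)

theorem Dat.cost_update {d : ℕ} (v : ℕ → ZMod m → ℤ) {s : ℕ} (hs : s < d) (x : ZMod m → ℤ) :
    D.cost d (Function.update v (s+1) x) = D.cost d v - D.F (v (s+1)) + D.F x := by
  unfold Dat.cost
  rw [← Finset.add_sum_erase _ _ (Finset.mem_range.mpr hs),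
    ← Finset.add_sum_erase _ (fun s => D.F (v (s+1))) (Finset.mem_range.mpr hs)]
  have : ∑ t ∈ (range d).erase s, D.F (Function.update v (s+1) x (t+1)) =
      ∑ t ∈ (range d).erase s, D.F (v (t+1)) := by
    apply Finset.sum_congr rfl; intro t ht
    rw [Function.update_of_ne (by have := Finset.ne_of_mem_erase ht; omega)]
  rw [this, Function.update_self]; ring

/-- uniqueness within the interleaved window -/
theorem Dat.window {d u} (hu : D.Greedy d u) {y : ℕ → ZMod m → ℤ} (hy : D.Chain d y)
    (hup : ∀ s, s < d → ∀ j, y s j ≤ u (s+1) j) :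
    D.cost d u ≤ D.cost d y ∧ (D.cost d y ≤ D.cost d u → ∀ s, s ≤ d → y s = u s) := by
  let W : Set (ℕ → ZMod m → ℤ) := {v | D.Chain d v ∧ ∀ s, s < d → ∀ j, v s j ≤ u (s+1) j}
  have key : ∀ v ∈ W, (∀ w ∈ W, D.cost d v ≤ D.cost d w) → ∀ s, s ≤ d → v s = u s := by
    intro v hv hopt
    have huW : u ∈ W := ⟨hu.1, fun s hs j => by have := hu.1.2.1 s hs j; omega⟩
    apply Dat.Loc.cost_lt (D := D) ⟨hu, hv.1, hv.2, ?_⟩ (hopt u huW)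
    intro s hs x hx h1 h2
    have hW : Function.update v (s+1) x ∈ W := by
      refine ⟨⟨?_, ?_, ?_⟩, ?_⟩
      · rw [Function.update_of_ne (by omega)]; exact hv.1.1
      · intro t ht j
        by_cases q1 : t = s + 1
        · subst q1
          rw [Function.update_self, Function.update_of_ne (by omega)]
          exact (h2 ht j).1
        · rw [Function.update_of_ne q1]
          by_cases q2 : t = s
          · subst q2; rw [Function.update_self]; exact h1 j
          · rw [Function.update_of_ne (by omega)]; exact hv.1.2.1 t ht j
      · intro t ht
        by_cases q1 : t = s + 1
        · subst q1; rw [Function.update_self]; exact hx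
        · rw [Function.update_of_ne q1]; exact hv.1.2.2 t ht
      · intro t ht j
        by_cases q1 : t = s + 1
        · subst q1; rw [Function.update_self]; exact (h2 ht j).2
        · rw [Function.update_of_ne q1]; exact hv.2 t ht j
    have := hopt _ hW
    rw [D.cost_update v hs] at this
    linarith
  have hyW : y ∈ W := ⟨hy, hup⟩
  obtain ⟨v, hv, hm⟩ := (InvImage.wf (fun x => (D.cost d x).toNat) Nat.lt_wfRel.wf).has_min W ⟨y, hyW⟩
  have hopt : ∀ w ∈ W, D.cost d v ≤ D.cost d w := by
    intro w hw
    have h1 : ¬ (D.cost d w).toNat < (D.cost d v).toNat := hm w hw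
    have := D.cost_nonneg d v
    have := D.cost_nonneg d w
    omega
  have hvu := key v hv hopt
  have hcu : D.cost d v = D.cost d u := by
    apply Finset.sum_congr rfl; intro s hs
    rw [hvu (s+1) (by simpa using hs)]
  refine ⟨by rw [← hcu]; exact hopt y hyW, fun hle => ?_⟩
  apply key y hyW
  intro w hw
  have := hopt w hw
  linarith

theorem Dat.phi {d u} (hu : D.Greedy d u) {c : ℕ → ZMod m → ℤ} (hc : D.Chain d c) :
    ∃ x y, D.Chain d x ∧ x 0 = 0 ∧ (∀ s, x (s+1) = vmax (u (s+1)) (c s)) ∧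
      D.Chain d y ∧ (∀ s, s < d → ∀ j, y s j ≤ u (s+1) j) ∧
      (∀ s, s < d → y s = vmin (u (s+1)) (c s)) ∧ y d = c d ∧
      D.cost d x + D.cost d y ≤ D.cost d u + D.cost d c := by
  let x : ℕ → ZMod m → ℤ := fun s => if s = 0 then 0 else vmax (u s) (c (s-1))
  let y : ℕ → ZMod m → ℤ := fun s => if s < d then vmin (u (s+1)) (c s) else c s
  have hx : ∀ s, x (s+1) = vmax (u (s+1)) (c s) := fun s => by simp [x]
  have hy : ∀ s, s < d → y s = vmin (u (s+1)) (c s) := fun s hs => by simp [y, hs]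
  have hyd : y d = c d := by simp [y]
  have lat := fun s (hs : s < d) => D.lattice (hu.1.2.2 (s+1) hs) (hc.2.2 s hs.le)
  have hx0 : x 0 = 0 := by simp [x]
  have hy0 : y 0 = 0 := by
    rcases Nat.eq_zero_or_pos d with h0 | h0
    · subst h0; rw [hyd]; exact hc.1
    · rw [hy 0 h0, hc.1]; funext j
      have := hu.1.ge (s := 1) h0 j
      unfold vmin; simp at this ⊢; omega
  refine ⟨x, y, ⟨hx0, ?_, ?_⟩, hx0, hx, ⟨hy0, ?_, ?_⟩, ?_, hy, hyd, ?_⟩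
  · intro s hs j
    rcases Nat.eq_zero_or_pos s with h0 | h0
    · subst h0; rw [hx, hx0]
      have := hu.1.ge (s := 1) hs j
      unfold vmax; simp at this ⊢; omega
    · obtain ⟨s, rfl⟩ : ∃ s', s = s' + 1 := ⟨s-1, by omega⟩
      rw [hx, hx]
      have h1 := hu.1.2.1 (s+1) hs j
      have h2 := hc.2.1 s (by omega) j
      unfold vmax; omega
  · intro s hs
    rcases Nat.eq_zero_or_pos s with h0 | h0
    · subst h0; rw [hx0]; exact D.ok_zero
    · obtain ⟨s, rfl⟩ : ∃ s', s = s' + 1 := ⟨s-1, by omega⟩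
      rw [hx]; exact (lat s hs).1
  · intro s hs j
    rw [hy s hs]
    have h2 := hc.2.1 s hs j
    rcases Nat.lt_or_ge (s+1) d with h | h
    · rw [hy _ h]
      have h1 := hu.1.2.1 (s+1) h j
      unfold vmin; omega
    · have e : s + 1 = d := by omega
      rw [e, hyd, ← e]; unfold vmin; omega
  · intro s hs
    rcases hs.lt_or_eq with h | h
    · rw [hy s h]; exact (lat s h).2.1
    · rw [h, hyd]; exact hc.2.2 d le_rfl
  · intro s hs j; rw [hy s hs]; exact min_le_left _ _
  · have h1 := D.uncross (d := d) hu.1.2.2 hc.2.2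
    rw [D.cost_eq d hc.1, D.cost_eq d hy0, hyd]
    have h2 : D.cost d x = ∑ s ∈ range d, D.F (vmax (u (s+1)) (c s)) := by
      apply Finset.sum_congr rfl; intro s _; rw [hx]
    have h3 : ∑ s ∈ range d, D.F (y s) = ∑ s ∈ range d, D.F (vmin (u (s+1)) (c s)) := by
      apply Finset.sum_congr rfl; intro s hs; rw [hy s (by simpa using hs)]
    rw [h2, h3]
    have h4 : D.cost d u = ∑ s ∈ range d, D.F (u (s+1)) := rfl
    linarith

/-- the greedy chain is optimal -/
theorem Dat.greedy_opt {d u} (hu : D.Greedy d u) : ∀ (e r : ℕ), r + e = d → ∀ c, D.Chain d c →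
    (∀ t, t ≤ r → c t = u t) → D.cost d u ≤ D.cost d c := by
  intro e
  induction e with
  | zero =>
    intro r hr c hc h
    apply le_of_eq
    apply Finset.sum_congr rfl; intro s hs
    rw [h (s+1) (by have := Finset.mem_range.mp hs; omega)]
  | succ e ih =>
    intro r hr c hc h
    obtain ⟨x, y, h1, h2, h3, h4, h5, -, -, h6⟩ := D.phi hu hc
    have := ih (r+1) (by omega) x h1 (by
      intro t ht
      rcases Nat.eq_zero_or_pos t with h0 | h0
      · subst h0; rw [h2, hu.1.1]
      · obtain ⟨t, rfl⟩ : ∃ s', t = s' + 1 := ⟨t-1, by omega⟩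
        rw [h3, h t (by omega)]
        funext j
        have := hu.1.2.1 t (by omega) j
        unfold vmax; omega)
    have := (D.window hu h4 h5).1
    linarith

theorem Dat.greedy_le {d u} (hu : D.Greedy d u) {c} (hc : D.Chain d c) :
    D.cost d u ≤ D.cost d c :=
  D.greedy_opt hu d 0 (by omega) c hc (by
    intro t ht; have : t = 0 := by omega
    subst this; rw [hc.1, hu.1.1])

theorem Dat.greedy_unique {d u} (hu : D.Greedy d u) {c} (hc : D.Chain d c)
    (hle : D.cost d c ≤ D.cost d u) : ∀ s, s ≤ d → c s = u s := by
  obtain ⟨x, y, h1, h2, h3, h4, h5, h7, h8, h6⟩ := D.phi hu hc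
  have hxu := D.greedy_le hu h1
  have := (D.window hu h4 h5).2 (by linarith)
  intro s hs
  rcases hs.lt_or_eq with h | h
  · have e := this s hs
    rw [h7 s h] at e
    funext j
    have e' := congrFun e j
    have := hu.1.2.1 s h j
    unfold vmin at e'; omega
  · rw [h, ← h8]; exact this d le_rfl

/-- strict convexity of the optimal costs -/
theorem Dat.convex {d : ℕ} {a b c : ℕ → ZMod m → ℤ} (ha : D.Greedy (d+2) a) (hb : D.Greedy (d+1) b)
    (hc : D.Greedy d c) : 2 * D.cost (d+1) b < D.cost (d+2) a + D.cost d c := by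
  let x : ℕ → ZMod m → ℤ := fun s => if s = 0 then 0 else vmax (a s) (c (s-1))
  let y : ℕ → ZMod m → ℤ := fun s => if s ≤ d then vmin (a (s+1)) (c s) else a (s+1)
  have hx : ∀ s, x (s+1) = vmax (a (s+1)) (c s) := fun s => by simp [x]
  have hy : ∀ s, s ≤ d → y s = vmin (a (s+1)) (c s) := fun s hs => by simp [y, hs]
  have hyd : y (d+1) = a (d+2) := by simp [y]
  have hx0 : x 0 = 0 := by simp [x]
  have hy0 : y 0 = 0 := by
    rw [hy 0 (by omega), hc.1.1]; funext j
    have := ha.1.ge (s := 1) (by omega) j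
    unfold vmin; simp at this ⊢; omega
  have lat := fun s (hs : s ≤ d) => D.lattice (ha.1.2.2 (s+1) (by omega)) (hc.1.2.2 s hs)
  have chx : D.Chain (d+1) x := by
    refine ⟨hx0, ?_, ?_⟩
    · intro s hs j
      rcases Nat.eq_zero_or_pos s with h0 | h0
      · subst h0; rw [hx, hx0]
        have := ha.1.ge (s := 1) (by omega) j
        unfold vmax; simp at this ⊢; omega
      · obtain ⟨s, rfl⟩ : ∃ s', s = s' + 1 := ⟨s-1, by omega⟩
        rw [hx, hx]
        have h1 := ha.1.2.1 (s+1) (by omega) j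
        have h2 := hc.1.2.1 s (by omega) j
        unfold vmax; omega
    · intro s hs
      rcases Nat.eq_zero_or_pos s with h0 | h0
      · subst h0; rw [hx0]; exact D.ok_zero
      · obtain ⟨s, rfl⟩ : ∃ s', s = s' + 1 := ⟨s-1, by omega⟩
        rw [hx]; exact (lat s (by omega)).1
  have chy : D.Chain (d+1) y := by
    refine ⟨hy0, ?_, ?_⟩
    · intro s hs j
      rw [hy s (by omega)]
      have h1 : a (s+1) j + 1 ≤ a (s+2) j := ha.1.2.1 (s+1) (by omega) j
      rcases Nat.lt_or_ge s d with h | h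
      · have e2 : y (s+1) = vmin (a (s+2)) (c (s+1)) := hy (s+1) h
        rw [e2]
        have h2 := hc.1.2.1 s h j
        unfold vmin; omega
      · have e : s = d := by omega
        subst e; rw [hyd]; unfold vmin; omega
    · intro s hs
      rcases hs.lt_or_eq with h | h
      · rw [hy s (by omega)]; exact (lat s (by omega)).2.1
      · rw [h, hyd]; exact ha.1.2.2 _ le_rfl
  have hsum : D.cost (d+1) x + D.cost (d+1) y ≤ D.cost (d+2) a + D.cost d c := by
    have h1 : D.cost (d+1) x = ∑ s ∈ range (d+1), D.F (vmax (a (s+1)) (c s)) := by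
      apply Finset.sum_congr rfl; intro s _; rw [hx]
    have h2 : D.cost (d+1) y = ∑ s ∈ range (d+1), D.F (vmin (a (s+1)) (c s)) + D.F (a (d+2)) := by
      rw [D.cost_eq _ hy0, hyd]; congr 1
      apply Finset.sum_congr rfl; intro s hs; rw [hy s (by have := Finset.mem_range.mp hs; omega)]
    have h3 : D.cost (d+2) a = ∑ s ∈ range (d+1), D.F (a (s+1)) + D.F (a (d+2)) :=
      Finset.sum_range_succ _ _
    have h4 : D.cost d c = ∑ s ∈ range (d+1), D.F (c s) := by
      rw [D.cost_eq _ hc.1.1, Finset.sum_range_succ]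
    rw [h1, h2, h3, h4, ]
    have : ∑ s ∈ range (d+1), D.F (vmax (a (s+1)) (c s)) + ∑ s ∈ range (d+1), D.F (vmin (a (s+1)) (c s))
      ≤ ∑ s ∈ range (d+1), D.F (a (s+1)) + ∑ s ∈ range (d+1), D.F (c s) := by
      rw [← Finset.sum_add_distrib, ← Finset.sum_add_distrib]
      apply Finset.sum_le_sum; intro s hs
      exact (lat s (by have := Finset.mem_range.mp hs; omega)).2.2
    linarith
  by_contra hcon
  have hbx := D.greedy_le hb chx
  have hby := D.greedy_le hb chy
  have ux := D.greedy_unique hb chx (by linarith)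
  have uy := D.greedy_unique hb chy (by linarith)
  have hxy : ∀ s, s ≤ d + 1 → x s = y s := fun s hs => (ux s hs).trans (uy s hs).symm
  have down : ∀ e s, s + e = d → c s = a (s+2) := by
    intro e
    induction e with
    | zero =>
      intro s hs
      have hs : s = d := by omega
      subst hs
      have e := hxy (s+1) le_rfl
      rw [hx, hyd] at e
      funext j
      have e' := congrFun e j
      have := ha.1.2.1 (s+1) (by omega) j
      have e2 : s + 1 + 1 = s + 2 := rfl
      rw [e2] at this
      unfold vmax at e'; omega
    | succ e ih =>
      intro s hs
      have ih := ih (s+1) (by omega)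
      have e := hxy (s+1) (by omega)
      rw [hx, hy _ (by omega), ih] at e
      funext j
      have e' := congrFun e j
      have h1 := ha.1.2.1 (s+1) (by omega) j
      have h2 := ha.1.2.1 (s+2) (by omega) j
      unfold vmax vmin at e'
      have e2 : s + 1 + 1 = s + 2 := rfl
      have e3 : s + 1 + 2 = s + 2 + 1 := rfl
      rw [e2] at h1
      rw [e2, e3] at e'
      omega
  have h0 := congrFun (down d 0 (by omega)) 0
  rw [hc.1.1] at h0
  have := ha.1.ge (s := 2) (by omega) 0
  simp at h0 this
  omega
end Comb3
end WPS

namespace WPS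
open Finset
section PowerSums
variable {R : Type} [Field R]

def IsCh (B : ℕ → ℕ → R) : ℕ → List ℕ → Prop
  | _, [] => True
  | n, i :: l => i < n ∧ B n i ≠ 0 ∧ IsCh B i l

theorem coeff_zero_of_chains {B : ℕ → ℕ → R} {T : ℕ → ℕ → Polynomial R}
    (hT0 : ∀ n, T 0 n = 1)
    (hT : ∀ r n, T (r+1) n = ∑ i ∈ range n, Polynomial.C (B n i) * (Polynomial.X ^ i * T r i)) :
    ∀ r n e, (∀ l, IsCh B n l → l.length = r → l.sum < e) → ∀ e', e ≤ e' → (T r n).coeff e' = 0 := by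
  intro r
  induction r with
  | zero =>
    intro n e h e' he
    have := h [] trivial rfl
    rw [hT0, Polynomial.coeff_one, if_neg]
    simp at this; omega
  | succ r ih =>
    intro n e h e' he
    rw [hT, Polynomial.finsetSum_coeff]
    apply Finset.sum_eq_zero
    intro i hi
    rw [Polynomial.coeff_C_mul, Polynomial.coeff_X_pow_mul']
    by_cases hB : B n i = 0
    · rw [hB, zero_mul]
    · split_ifs with hle
      · rw [ih i (e - i) _ (e' - i) (by omega), mul_zero]
        intro l hl hr
        have := h (i :: l) ⟨mem_range.mp hi, hB, hl⟩ (by simp [hr])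
        simp at this; omega
      · rw [mul_zero]

theorem coeff_ne_zero_of_chains {B : ℕ → ℕ → R} {T : ℕ → ℕ → Polynomial R}
    (hT0 : ∀ n, T 0 n = 1)
    (hT : ∀ r n, T (r+1) n = ∑ i ∈ range n, Polynomial.C (B n i) * (Polynomial.X ^ i * T r i)) :
    ∀ r n l₀, IsCh B n l₀ → l₀.length = r →
    (∀ l, IsCh B n l → l.length = r → l ≠ l₀ → l.sum < l₀.sum) → (T r n).coeff l₀.sum ≠ 0 := by
  intro r
  induction r with
  | zero =>
    intro n l₀ _ h0 _
    rw [List.length_eq_zero_iff] at h0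
    subst h0
    simp [hT0]
  | succ r ih =>
    intro n l₀ hc hlen h
    match l₀, hc, hlen, h with
    | i₀ :: l', hc, hlen, h =>
    have h1 : l'.length = r := by simpa using hlen
    rw [hT, Polynomial.finsetSum_coeff, Finset.sum_eq_single i₀]
    · rw [Polynomial.coeff_C_mul, Polynomial.coeff_X_pow_mul', if_pos (by simp)]
      apply mul_ne_zero hc.2.1
      have e : (i₀ :: l').sum - i₀ = l'.sum := by simp
      rw [e]
      apply ih _ _ hc.2.2 h1
      intro l hl hr hne
      have := h (i₀ :: l) ⟨hc.1, hc.2.1, hl⟩ (by simp [hr]) (by simpa using hne)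
      simpa using this
    · intro i hi hne
      rw [Polynomial.coeff_C_mul, Polynomial.coeff_X_pow_mul']
      by_cases hB : B n i = 0
      · rw [hB, zero_mul]
      · split_ifs with hle
        · rw [coeff_zero_of_chains hT0 hT r i ((i₀ :: l').sum - i) _ _ le_rfl, mul_zero]
          intro l hl hr
          have := h (i :: l) ⟨mem_range.mp hi, hB, hl⟩ (by simp [hr]) (by simp [hne])
          simp only [List.sum_cons] at this ⊢; omega
        · rw [mul_zero]
    · intro h'
      exact absurd (mem_range.mpr hc.1) h'

variable (R) [Fintype R]
open Classical in
noncomputable def Mon : ℕ → Finset (Polynomial R)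
  | 0 => {1}
  | d+1 => ((Mon d) ×ˢ (Finset.univ : Finset R)).image
      (fun x => Polynomial.X * x.1 + Polynomial.C x.2)

theorem mem_Mon (d : ℕ) : ∀ a : Polynomial R, a ∈ Mon R d ↔ a.Monic ∧ a.natDegree = d := by
  induction d with
  | zero =>
    intro a
    simp only [Mon, mem_singleton]
    constructor
    · rintro rfl; simp
    · rintro ⟨h, h'⟩; exact (Polynomial.Monic.natDegree_eq_zero h).mp h'
  | succ d ih =>
    intro a
    simp only [Mon, mem_image, mem_product, mem_univ, and_true, Prod.exists]
    constructor
    · rintro ⟨b, c, hb, rfl⟩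
      rw [ih] at hb
      have hX : (Polynomial.X * b).Monic := Polynomial.monic_X.mul hb.1
      have hd : (Polynomial.X * b).natDegree = d + 1 := by
        rw [Polynomial.monic_X.natDegree_mul hb.1, hb.2, Polynomial.natDegree_X, add_comm]
      have hlt : (Polynomial.C c).degree < (Polynomial.X * b).degree := by
        rw [Polynomial.degree_eq_natDegree hX.ne_zero, hd]
        exact lt_of_le_of_lt Polynomial.degree_C_le (by exact_mod_cast Nat.succ_pos d)
      refine ⟨hX.add_of_left hlt, ?_⟩
      rw [Polynomial.natDegree_add_C, hd]
    · rintro ⟨h, h'⟩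
      refine ⟨a.divX, a.coeff 0, ?_, Polynomial.X_mul_divX_add a⟩
      rw [ih]
      have hn : a.divX.natDegree = d := by rw [Polynomial.natDegree_divX_eq_natDegree_tsub_one, h']; rfl
      refine ⟨?_, hn⟩
      rw [Polynomial.Monic, Polynomial.leadingCoeff, hn, Polynomial.coeff_divX, ← h']
      exact h

theorem powerSum_eq (d k : ℕ) : powerSum R d k = ∑ a ∈ Mon R d, a ^ k := by
  have h : {a : Polynomial R | a.Monic ∧ a.natDegree = d} = (Mon R d : Set (Polynomial R)) := by
    ext a; simp [mem_Mon]
  rw [powerSum, h, finsum_mem_coe_finset]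

noncomputable def Bc (n i : ℕ) : R := (n.choose i : R) * ∑ c : R, c ^ (n - i)

theorem powerSum_zero (k : ℕ) : powerSum R 0 k = 1 := by
  rw [powerSum_eq]; simp [Mon]

theorem powerSum_succ (d n : ℕ) : powerSum R (d+1) n =
    ∑ i ∈ range n, Polynomial.C (Bc R n i) * (Polynomial.X ^ i * powerSum R d i) := by
  classical
  have h0 : powerSum R (d+1) n = ∑ i ∈ range (n+1), Polynomial.C (Bc R n i) * (Polynomial.X ^ i * powerSum R d i) := by
    rw [powerSum_eq]
    simp only [Mon]
    rw [Finset.sum_image, Finset.sum_product]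
    · simp_rw [powerSum_eq, add_pow, Bc]
      rw [Finset.sum_congr rfl (fun a _ => Finset.sum_comm), Finset.sum_comm]
      apply Finset.sum_congr rfl
      intro i _
      simp_rw [Finset.mul_sum]
      apply Finset.sum_congr rfl
      intro a _
      rw [map_sum, Finset.sum_mul]
      apply Finset.sum_congr rfl
      intro c _
      simp only [map_mul, map_pow, map_natCast]
      ring
    · rintro ⟨a, c⟩ _ ⟨b, e⟩ _ h
      have h2 := congrArg (fun f => Polynomial.coeff f 0) h
      simp at h2
      subst h2
      have h1 := mul_left_cancel₀ Polynomial.X_ne_zero (add_right_cancel h)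
      simpa using h1
  rw [h0, Finset.sum_range_succ]
  have : Bc R n n = 0 := by simp [Bc]
  rw [this]; simp

theorem sum_pow_ne_zero (r : ℕ) (hr : 0 < r) : (∑ c : R, c ^ r) ≠ 0 ↔ (Fintype.card R - 1) ∣ r := by
  classical
  have h := FiniteField.sum_pow_units R r
  have h2 : ∑ c : R, c ^ r = ∑ x : Rˣ, ((x : R) ^ r) := by
    rw [← Finset.sum_filter_add_sum_filter_not univ (fun c : R => c ≠ 0)]
    rw [Finset.sum_eq_zero (s := univ.filter (fun c : R => ¬ c ≠ 0)), add_zero]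
    · symm
      apply Finset.sum_bij (fun (x : Rˣ) _ => (x : R))
      · intro x _; simp
      · intro x _ y _ h; exact Units.ext h
      · intro c hc; simp at hc; exact ⟨Units.mk0 c hc, by simp, by simp⟩
      · intro x _; rfl
    · intro c hc; simp at hc; simp [hc, hr.ne']
  rw [h2, h]
  split_ifs with h3 <;> simp [h3]

theorem Bc_ne_zero (p : ℕ) [CharP R p] (n i : ℕ) (h : i < n) :
    Bc R n i ≠ 0 ↔ ¬ p ∣ n.choose i ∧ (Fintype.card R - 1) ∣ n - i := by
  rw [Bc, mul_ne_zero_iff, sum_pow_ne_zero R _ (by omega), Ne, CharP.cast_eq_zero_iff R p]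

end PowerSums
end WPS

namespace WPS
open Finset
section Transl

theorem e_cast {R : Type} [CommRing R] {m : ℕ} (P : R) (h : P ^ m = 1) (t : ℕ) :
    P ^ ((t : ZMod m)).val = P ^ t := by
  rw [ZMod.val_natCast]
  conv_rhs => rw [← Nat.mod_add_div t m]
  rw [pow_add, pow_mul, h, one_pow, mul_one]

theorem e_succ {R : Type} [CommRing R] {m : ℕ} [NeZero m] (P : R) (h : P ^ m = 1) (j : ZMod m) :
    P ^ (j + 1).val = P * P ^ j.val := by
  have e : j + 1 = ((j.val + 1 : ℕ) : ZMod m) := by push_cast; rw [ZMod.natCast_zmod_val]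
  rw [e, e_cast P h, pow_succ, mul_comm]

theorem pow_cast_one (p m : ℕ) (hp : 2 ≤ p) : ((p : ℕ) : ZMod (p ^ m - 1)) ^ m = 1 := by
  have h1 : 1 ≤ p ^ m := Nat.one_le_pow _ _ (by omega)
  have : ((p ^ m - 1 + 1 : ℕ) : ZMod (p ^ m - 1)) = 1 := by
    rw [Nat.cast_add, ZMod.natCast_self]; simp
  rw [Nat.sub_add_cancel h1] at this
  exact_mod_cast this

variable {m : ℕ} [NeZero m]

theorem val_term (P : ℤ) (x : ZMod m) :
    P * P ^ (x - 1).val - P ^ x.val = if x = 0 then P ^ m - 1 else 0 := by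
  have e : x = (((x-1).val + 1 : ℕ) : ZMod m) := by push_cast; rw [ZMod.natCast_zmod_val]; ring
  have h1 := ZMod.val_lt (x - 1)
  have h2 : x.val = ((x-1).val + 1) % m := by
    conv_lhs => rw [e]
    rw [ZMod.val_natCast]
  rcases Nat.lt_or_ge ((x-1).val + 1) m with h | h
  · rw [Nat.mod_eq_of_lt h] at h2
    rw [if_neg, h2, pow_succ]
    · ring
    · rintro rfl; simp at h2
  · have h3 : (x-1).val + 1 = m := by omega
    rw [h3, Nat.mod_self] at h2
    rw [if_pos ((ZMod.val_eq_zero x).mp h2), h2]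
    conv_rhs => rw [← h3]
    rw [pow_succ]; ring

theorem class_dvd (p : ℕ) (hp : 2 ≤ p) (L : ℕ) (a : ZMod m → ℤ) (w : ℕ → ℤ)
    (h : ∀ j : ZMod m, ∑ t ∈ range L, (if (t : ZMod m) = j then w t else 0) = p * a j - a (j-1)) :
    ((p ^ m - 1 : ℕ) : ℤ) ∣ ∑ t ∈ range L, (p:ℤ) ^ t * w t := by
  rw [← ZMod.intCast_zmod_eq_zero_iff_dvd]
  have hP := pow_cast_one p m hp
  set P : ZMod (p ^ m - 1) := (p : ZMod (p ^ m - 1)) with hPdef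
  push_cast
  have e1 : ∑ t ∈ range L, P ^ t * (w t : ZMod (p ^ m - 1)) =
      ∑ j : ZMod m, P ^ j.val * ((p * a j - a (j-1) : ℤ) : ZMod (p ^ m - 1)) := by
    have e2 : ∀ j : ZMod m, P ^ j.val * ((p * a j - a (j-1) : ℤ) : ZMod (p ^ m - 1)) =
        ∑ t ∈ range L, (if (t : ZMod m) = j then P ^ t * (w t : ZMod (p ^ m - 1)) else 0) := by
      intro j
      rw [← h j]
      push_cast
      rw [Finset.mul_sum]
      apply Finset.sum_congr rfl; intro t _
      split_ifs with hj
      · rw [← hj, e_cast P hP]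
      · simp
    rw [Finset.sum_congr rfl (fun j _ => e2 j), Finset.sum_comm]
    simp
  rw [e1]
  push_cast
  simp_rw [mul_sub]
  rw [Finset.sum_sub_distrib, sub_eq_zero]
  rw [← Equiv.sum_comp (Equiv.addRight (1 : ZMod m)) (fun j => P ^ j.val * (a (j-1) : ZMod (p ^ m - 1)))]
  apply Finset.sum_congr rfl; intro j _
  simp only [Equiv.coe_addRight, add_sub_cancel_right]
  rw [e_succ P hP]; ring

theorem exists_vec (p : ℕ) (hp : 2 ≤ p) (L : ℕ) (w : ℕ → ℤ)
    (h : ((p ^ m - 1 : ℕ) : ℤ) ∣ ∑ t ∈ range L, (p:ℤ) ^ t * w t) :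
    ∃ a : ZMod m → ℤ, ∀ j : ZMod m,
      p * a j - a (j-1) = ∑ t ∈ range L, (if (t : ZMod m) = j then w t else 0) := by
  have hQ : ((p ^ m - 1 : ℕ) : ℤ) = (p : ℤ) ^ m - 1 := by
    rw [Nat.cast_sub (Nat.one_le_pow _ _ (by omega))]; push_cast; rfl
  have hP := pow_cast_one p m hp
  have hpos : (0 : ℤ) < (p : ℤ) ^ m - 1 := by
    have : 1 < p ^ m := Nat.one_lt_pow (NeZero.ne m) (by omega)
    have : (1 : ℤ) < (p : ℤ) ^ m := by exact_mod_cast this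
    omega
  let Y : ZMod m → ℤ := fun j => ∑ t ∈ range L, w t * (p : ℤ) ^ ((t : ZMod m) - j - 1).val
  have hY : ∀ j, p * Y j - Y (j-1) =
      ((p : ℤ) ^ m - 1) * ∑ t ∈ range L, (if (t : ZMod m) = j then w t else 0) := by
    intro j
    simp only [Y]
    rw [Finset.mul_sum, ← Finset.sum_sub_distrib, Finset.mul_sum]
    apply Finset.sum_congr rfl; intro t _
    have h1 := val_term (p : ℤ) ((t : ZMod m) - j)
    have e : (t : ZMod m) - (j-1) - 1 = t - j := by ring
    rw [e]
    simp only [sub_eq_zero] at h1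
    split_ifs at h1 ⊢ with h2
    · linear_combination w t * h1
    · linear_combination w t * h1
  have hdvd : ∀ j, ((p : ℤ) ^ m - 1) ∣ Y j := by
    apply cyc' (P := fun j => ((p : ℤ) ^ m - 1) ∣ Y j) (-1)
    · rw [← hQ, ← ZMod.intCast_zmod_eq_zero_iff_dvd]
      rw [← ZMod.intCast_zmod_eq_zero_iff_dvd] at h
      rw [← h]
      simp only [Y]
      push_cast
      apply Finset.sum_congr rfl; intro t _
      have e : (t : ZMod m) - -1 - 1 = t := by ring
      rw [e, e_cast _ hP, mul_comm]
    · intro j hj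
      have : Y (j-1) = p * Y j - ((p : ℤ) ^ m - 1) * ∑ t ∈ range L, (if (t : ZMod m) = j then w t else 0) := by
        rw [← hY j]; ring
      rw [this]
      exact dvd_sub (Dvd.dvd.mul_left hj _) (dvd_mul_right _ _)
  choose a ha using hdvd
  refine ⟨a, fun j => ?_⟩
  have h1 := hY j
  rw [ha j, ha (j-1)] at h1
  apply mul_left_cancel₀ hpos.ne'
  rw [← h1]; ring

/-- base `p` digit -/
def dig (p n t : ℕ) : ℕ := n / p ^ t % p

theorem dig_sum (p : ℕ) (hp : 2 ≤ p) : ∀ (L n : ℕ), n < p ^ L → ∑ t ∈ range L, p ^ t * dig p n t = n := by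
  intro L
  induction L with
  | zero => intro n h; simp at h; simp [h]
  | succ L ih =>
    intro n h
    rw [Finset.sum_range_succ']
    have h1 : n / p < p ^ L := by
      rw [Nat.div_lt_iff_lt_mul (by omega)]; rwa [pow_succ] at h
    have h2 := ih _ h1
    have h3 : ∑ t ∈ range L, p ^ (t+1) * dig p n (t+1) = p * (n / p) := by
      conv_rhs => rw [← h2]
      rw [Finset.mul_sum]
      apply Finset.sum_congr rfl; intro t _
      unfold dig
      rw [pow_succ', Nat.div_div_eq_div_mul]; ring
    rw [h3]; unfold dig; simp [Nat.div_add_mod]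

theorem dig_lt (p : ℕ) (hp : 2 ≤ p) (n t : ℕ) : dig p n t < p := Nat.mod_lt _ (by omega)

theorem dig_zero_of_ge (p : ℕ) (hp : 2 ≤ p) {L n t : ℕ} (h : n < p ^ L) (ht : L ≤ t) : dig p n t = 0 := by
  unfold dig
  rw [Nat.div_eq_of_lt (lt_of_lt_of_le h (Nat.pow_le_pow_right (by omega) ht))]; simp

theorem dig_unique (p : ℕ) (hp : 2 ≤ p) : ∀ (L : ℕ) (w : ℕ → ℕ), (∀ t, w t < p) →
    ∀ t, t < L → dig p (∑ t ∈ range L, p ^ t * w t) t = w t := by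
  intro L
  induction L with
  | zero => intro w _ t h; omega
  | succ L ih =>
    intro w hw t ht
    rw [Finset.sum_range_succ']
    have e : ∑ t ∈ range L, p ^ (t+1) * w (t+1) = p * ∑ t ∈ range L, p ^ t * w (t+1) := by
      rw [Finset.mul_sum]; apply Finset.sum_congr rfl; intro t _; rw [pow_succ']; ring
    rw [e]
    match t with
    | 0 => unfold dig; simp [Nat.add_mod, Nat.mod_eq_of_lt (hw 0)]
    | t+1 =>
      have := ih (fun t => w (t+1)) (fun t => hw _) t (by omega)
      rw [← this]; unfold dig
      rw [pow_succ', ← Nat.div_div_eq_div_mul]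
      have : (p * ∑ t ∈ range L, p ^ t * w (t+1) + p ^ 0 * w 0) / p = ∑ t ∈ range L, p ^ t * w (t+1) := by
        rw [Nat.mul_add_div (by omega), pow_zero, one_mul, Nat.div_eq_of_lt (hw 0), add_zero]
      rw [this]

theorem lucas (p : ℕ) (hp : p.Prime) {L n i : ℕ} (hn : n < p ^ L) (hi : i < p ^ L) :
    ¬ p ∣ n.choose i ↔ ∀ t, t < L → dig p i t ≤ dig p n t := by
  have := Fact.mk hp
  have h := Choose.choose_modEq_prod_range_choose_nat hn hi
  rw [Nat.dvd_iff_mod_eq_zero, h, ← Nat.dvd_iff_mod_eq_zero, hp.prime.dvd_finsetProd_iff]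
  push Not
  apply forall_congr'; intro t
  rw [mem_range]
  apply imp_congr_right; intro _
  change ¬ p ∣ (dig p n t).choose (dig p i t) ↔ _
  have hlt := dig_lt p hp.two_le n t
  constructor
  · intro h1; by_contra h2
    rw [Nat.choose_eq_zero_of_lt (by omega)] at h1; simp at h1
  · intro h1 h2
    have h3 : p ∣ (dig p n t).factorial := by
      rw [← Nat.choose_mul_factorial_mul_factorial h1, mul_assoc]
      exact Dvd.dvd.mul_right h2 _
    rw [hp.dvd_factorial] at h3; omega

end Transl
end WPS

namespace WPS
open Finset
section Transl2
set_option linter.unusedSectionVars false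
variable {m : ℕ} [NeZero m]

/-- digit data of `k` -/
def datK (m p k L : ℕ) (hp : 2 ≤ p) : Dat m where
  p := p
  kd := fun t => dig p k t
  L := L
  hp := by exact_mod_cast hp
  h0 := fun t => by positivity
  h1 := fun t => by have := dig_lt p hp k t; omega

/-- one step of a chain -/
def Rel (m p n i : ℕ) : Prop := i < n ∧ ¬ p ∣ n.choose i ∧ (p ^ m - 1) ∣ n - i

theorem chain_of_fun {p k L : ℕ} (hp : p.Prime) (hk : k < p ^ L) {d : ℕ} {f : ℕ → ℕ}
    (f0 : f 0 = k) (hf : ∀ s, s < d → Rel m p (f s) (f (s+1))) :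
    ∃ c, (datK m p k L hp.two_le).Chain d c ∧
      ∀ s, s ≤ d → (datK m p k L hp.two_le).F (c s) ≤ (k : ℤ) - f s := by
  classical
  set D := datK m p k L hp.two_le with hD
  have hle : ∀ s, s ≤ d → f s ≤ k := by
    intro s
    induction s with
    | zero => intro _; omega
    | succ s ih => intro h; have := ih (by omega); have := (hf s (by omega)).1; omega
  have hlt : ∀ s, s ≤ d → f s < p ^ L := fun s hs => lt_of_le_of_lt (hle s hs) hk
  have hstep : ∀ s, s < d → ∀ t, t < L → dig p (f (s+1)) t ≤ dig p (f s) t := fun s hs =>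
    (lucas p hp (hlt s hs.le) (hlt (s+1) hs)).mp (hf s hs).2.1
  have hdk : ∀ s, s ≤ d → ∀ t, t < L → dig p (f s) t ≤ dig p k t := by
    intro s
    induction s with
    | zero => intro _ t _; rw [f0]
    | succ s ih => intro h t ht; exact (hstep s h t ht).trans (ih (by omega) t ht)
  have hdvd : ∀ s, s ≤ d → ((p ^ m - 1 : ℕ) : ℤ) ∣ (k : ℤ) - f s := by
    intro s
    induction s with
    | zero => intro _; rw [f0]; simp
    | succ s ih =>
      intro h
      have h1 := ih (by omega)
      have h2 := (hf s h).2.2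
      have h3 := (hf s h).1
      have h4 : ((p ^ m - 1 : ℕ) : ℤ) ∣ ((f s - f (s+1) : ℕ) : ℤ) := Int.natCast_dvd_natCast.mpr h2
      rw [Nat.cast_sub h3.le] at h4
      have h5 := dvd_add h1 h4
      have e : (k : ℤ) - f s + ((f s : ℤ) - f (s+1)) = (k : ℤ) - f (s+1) := by ring
      rwa [e] at h5
  let y : ℕ → ℕ → ℤ := fun s t => (dig p k t : ℤ) - dig p (f s) t
  have hsum : ∀ s, s ≤ d → ∑ t ∈ range L, (p : ℤ) ^ t * y s t = (k : ℤ) - f s := by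
    intro s hs
    have h1 := dig_sum p hp.two_le L k hk
    have h2 := dig_sum p hp.two_le L (f s) (hlt s hs)
    conv_rhs => rw [← h1, ← h2]
    push_cast
    rw [← Finset.sum_sub_distrib]
    apply Finset.sum_congr rfl; intro t _; simp only [y]; ring
  have hex : ∀ s, ∃ a : ZMod m → ℤ, s ≤ d → ∀ j : ZMod m,
      D.n a j = ∑ t ∈ range L, (if (t : ZMod m) = j then y s t else 0) := by
    intro s
    by_cases hs : s ≤ d
    · obtain ⟨a, ha⟩ := exists_vec (m := m) p hp.two_le L (y s) (by rw [hsum s hs]; exact hdvd s hs)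
      exact ⟨a, fun _ => ha⟩
    · exact ⟨0, fun h => absurd h hs⟩
  choose c hc using hex
  have ok : ∀ s, s ≤ d → D.Ok (c s) := by
    intro s hs j
    rw [hc s hs j]
    constructor
    · apply Finset.sum_nonneg; intro t ht
      have := hdk s hs t (mem_range.mp ht)
      split_ifs
      · simp only [y]; omega
      · exact le_rfl
    · apply Finset.sum_le_sum; intro t ht
      split_ifs
      · simp only [y]; change _ ≤ ((dig p k t : ℕ) : ℤ); omega
      · exact le_rfl
  refine ⟨c, ⟨?_, ?_, ok⟩, ?_⟩
  · apply D.n_inj; intro j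
    rw [hc 0 (by omega), D.n_zero]
    apply Finset.sum_eq_zero; intro t _; simp [y, f0]
  · intro s hs j
    apply D.lt_of_n
    · intro j
      rw [hc s hs.le, hc (s+1) hs]
      apply Finset.sum_le_sum; intro t ht
      have := hstep s hs t (mem_range.mp ht)
      split_ifs
      · simp only [y]; omega
      · exact le_rfl
    · intro heq
      have h1 : ∀ s, s ≤ d → ∑ t ∈ range L, y s t = ∑ j : ZMod m, D.n (c s) j := by
        intro s hs
        rw [Finset.sum_congr rfl (fun j _ => hc s hs j), Finset.sum_comm]
        simp
      have h2 : ∑ t ∈ range L, y s t = ∑ t ∈ range L, y (s+1) t := by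
        rw [h1 s hs.le, h1 (s+1) hs, heq]
      rw [Finset.sum_eq_sum_iff_of_le] at h2
      · have h3 : (k : ℤ) - f s = (k : ℤ) - f (s+1) := by
          rw [← hsum s hs.le, ← hsum (s+1) hs]
          apply Finset.sum_congr rfl; intro t ht; rw [h2 t ht]
        have := (hf s hs).1
        omega
      · intro t ht
        have := hstep s hs t (mem_range.mp ht)
        simp only [y]; omega
  · intro s hs
    rw [← hsum s hs]
    apply D.F_min (ok s hs)
    · intro t ht
      have := hdk s hs t ht
      simp only [y]; omega
    · intro t ht
      change _ ≤ ((dig p k t : ℕ) : ℤ)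
      simp only [y]; omega
    · intro j; exact (hc s hs j).symm

theorem fun_of_greedy {p k L : ℕ} (hp : p.Prime) (hk : k < p ^ L) {d : ℕ} {u : ℕ → ZMod m → ℤ}
    (hu : (datK m p k L hp.two_le).Greedy d u) :
    ∃ f : ℕ → ℕ, f 0 = k ∧ (∀ s, s < d → Rel m p (f s) (f (s+1))) ∧
      ∀ s, s ≤ d → (f s : ℤ) = k - (datK m p k L hp.two_le).F (u s) := by
  set D := datK m p k L hp.two_le with hD
  have hkd : ∀ t, D.kd t = (dig p k t : ℤ) := fun t => rfl
  let w : ℕ → ℕ → ℕ := fun s t => (D.kd t - D.dv (u s) t).toNat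
  have hw : ∀ s t, (w s t : ℤ) = D.kd t - D.dv (u s) t := by
    intro s t
    have : D.dv (u s) t ≤ D.kd t := D.dg_le _ _
    simp only [w]; omega
  have hwp : ∀ s t, w s t < p := by
    intro s t
    have h1 := hw s t
    have h2 := dig_lt p hp.two_le k t
    have h3 := D.dv_nonneg (u s) t
    rw [hkd] at h1; omega
  let f : ℕ → ℕ := fun s => ∑ t ∈ range L, p ^ t * w s t
  have hf : ∀ s, (f s : ℤ) = k - D.F (u s) := by
    intro s
    have h1 := dig_sum p hp.two_le L k hk
    have h2 : D.F (u s) = ∑ t ∈ range L, (p : ℤ) ^ t * D.dv (u s) t := rfl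
    conv_rhs => rw [← h1, h2]
    simp only [f]
    push_cast
    rw [← Finset.sum_sub_distrib]
    apply Finset.sum_congr rfl; intro t _
    rw [hw, hkd]; ring
  have hle : ∀ s, f s ≤ k := by
    intro s; have := hf s; have := D.F_nonneg (u s); omega
  have hdig : ∀ s t, t < L → dig p (f s) t = w s t := fun s t ht =>
    dig_unique p hp.two_le L (w s) (hwp s) t ht
  have hdvd : ∀ s, s ≤ d → ((p ^ m - 1 : ℕ) : ℤ) ∣ D.F (u s) := by
    intro s hs
    exact class_dvd (m := m) p hp.two_le L (u s) (D.dv (u s)) (D.sum_dv (hu.1.2.2 s hs))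
  refine ⟨f, ?_, ?_, fun s _ => hf s⟩
  · have := hf 0; rw [hu.1.1, D.F_zero] at this; omega
  · intro s hs
    have hn := fun j => hu.nested hs j
    have h1 := D.F_mono hn
    have h2 : D.F (u s) ≠ D.F (u (s+1)) := by
      intro h
      have h3 := D.F_inj (hu.1.2.2 s hs.le) (hu.1.2.2 (s+1) hs) h
      have h4 := hu.1.2.1 s hs 0
      rw [h3] at h4; omega
    have e1 := hf s
    have e2 := hf (s+1)
    have hlt : f (s+1) < f s := by omega
    refine ⟨hlt, ?_, ?_⟩
    · rw [lucas p hp (lt_of_le_of_lt (hle s) hk) (lt_of_le_of_lt (hle (s+1)) hk)]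
      intro t ht
      rw [hdig s t ht, hdig (s+1) t ht]
      have := D.dv_mono hn t
      have := hw s t
      have := hw (s+1) t
      omega
    · rw [← Int.natCast_dvd_natCast, Nat.cast_sub hlt.le, e1, e2]
      have h5 := dvd_sub (hdvd (s+1) hs) (hdvd s hs.le)
      have e : D.F (u (s+1)) - D.F (u s) = (k : ℤ) - D.F (u s) - (k - D.F (u (s+1))) := by ring
      rwa [e] at h5

theorem isCh_iff {R : Type} [Field R] (B : ℕ → ℕ → R) : ∀ (l : List ℕ) (n : ℕ), IsCh B n l ↔
    ∀ s, s < l.length → (n :: l).getD (s+1) 0 < (n :: l).getD s 0 ∧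
      B ((n :: l).getD s 0) ((n :: l).getD (s+1) 0) ≠ 0 := by
  intro l
  induction l with
  | nil => intro n; simp [IsCh]
  | cons i l ih =>
    intro n
    simp only [IsCh]
    rw [ih i]
    constructor
    · rintro ⟨h1, h2, h3⟩ s hs
      match s with
      | 0 => exact ⟨h1, h2⟩
      | s+1 => exact h3 s (by simpa using hs)
    · intro h
      refine ⟨(h 0 (by simp)).1, (h 0 (by simp)).2, fun s hs => ?_⟩
      exact h (s+1) (by simpa using hs)

theorem list_sum_getD (l : List ℕ) : ∀ n : ℕ, l.sum = ∑ s ∈ range l.length, (n :: l).getD (s+1) 0 := by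
  induction l with
  | nil => intro n; simp
  | cons i l ih =>
    intro n
    rw [List.length_cons, Finset.sum_range_succ', List.sum_cons, ih i]
    rw [add_comm]; rfl

theorem main_deg {R : Type} [Field R] {B : ℕ → ℕ → R} {T : ℕ → ℕ → Polynomial R}
    (hT0 : ∀ n, T 0 n = 1)
    (hT : ∀ r n, T (r+1) n = ∑ i ∈ range n, Polynomial.C (B n i) * (Polynomial.X ^ i * T r i))
    {p k L : ℕ} (hp : p.Prime) (hk : k < p ^ L)
    (hB : ∀ n i, i < n → (B n i ≠ 0 ↔ ¬ p ∣ n.choose i ∧ (p ^ m - 1) ∣ n - i)) (d : ℕ) :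
    (T d k ≠ 0 → ∃ c, (datK m p k L hp.two_le).Chain d c) ∧
    (∀ u, (datK m p k L hp.two_le).Greedy d u → T d k ≠ 0 ∧
      ((T d k).natDegree : ℤ) = d * k - (datK m p k L hp.two_le).cost d u) := by
  set D := datK m p k L hp.two_le with hD
  have hrel : ∀ l, IsCh B k l → ∀ s, s < l.length →
      Rel m p ((k :: l).getD s 0) ((k :: l).getD (s+1) 0) := by
    intro l hl s hs
    obtain ⟨h1, h2⟩ := (isCh_iff B l k).mp hl s hs
    exact ⟨h1, (hB _ _ h1).mp h2⟩
  constructor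
  · intro hne
    by_contra hno
    apply hne
    apply Polynomial.ext; intro e
    rw [Polynomial.coeff_zero]
    apply coeff_zero_of_chains hT0 hT d k 0 _ e (Nat.zero_le _)
    intro l hl hlen
    exfalso; apply hno
    obtain ⟨c, h1, -⟩ := chain_of_fun (m := m) (L := L) (d := d) (f := fun s => (k :: l).getD s 0) hp hk rfl
      (fun s hs => hrel l hl s (by omega))
    exact ⟨c, h1⟩
  · intro u hu
    obtain ⟨f, f0, f1, f2⟩ := fun_of_greedy hp hk hu
    rw [← hD] at f2
    let l₀ : List ℕ := (List.range d).map (fun s => f (s+1))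
    have hlen₀ : l₀.length = d := by simp [l₀]
    have hget : ∀ s, s ≤ d → (k :: l₀).getD s 0 = f s := by
      intro s hs
      match s with
      | 0 => simp [f0]
      | s+1 => simp [l₀, List.getD_eq_getElem?_getD, List.getElem?_range (show s < d by omega)]
    have hl₀ : IsCh B k l₀ := by
      rw [isCh_iff]
      intro s hs
      rw [hlen₀] at hs
      rw [hget s hs.le, hget (s+1) hs]
      have := f1 s hs
      exact ⟨this.1, (hB _ _ this.1).mpr this.2⟩
    have hsum₀ : (l₀.sum : ℤ) = d * k - D.cost d u := by
      rw [list_sum_getD l₀ k, hlen₀]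
      push_cast
      rw [Finset.sum_congr rfl (g := fun s => (k : ℤ) - D.F (u (s+1)))]
      · rw [Finset.sum_sub_distrib]; simp [Dat.cost]
      · intro s hs
        have hs := mem_range.mp hs
        rw [hget (s+1) hs, f2 (s+1) hs]
    have hother : ∀ l, IsCh B k l → l.length = d → l ≠ l₀ → l.sum < l₀.sum := by
      intro l hl hlen hne
      by_contra hge
      apply hne
      obtain ⟨c, h1, h2⟩ := chain_of_fun (m := m) (L := L) (d := d) (f := fun s => (k :: l).getD s 0) hp hk rfl
        (fun s hs => hrel l hl s (by omega))
      rw [← hD] at h1 h2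
      have hs1 : (l.sum : ℤ) ≤ d * k - D.cost d c := by
        rw [list_sum_getD l k, hlen]
        push_cast
        have : ∑ s ∈ range d, ((k : ℤ) - D.F (c (s+1))) = d * k - D.cost d c := by
          rw [Finset.sum_sub_distrib]; simp [Dat.cost]
        rw [← this]
        apply Finset.sum_le_sum
        intro s hs
        have := h2 (s+1) (mem_range.mp hs)
        linarith
      have hcu : D.cost d c ≤ D.cost d u := by
        have : (l₀.sum : ℤ) ≤ l.sum := by exact_mod_cast not_lt.mp hge
        linarith
      have heq := D.greedy_unique hu h1 hcu
      have hle : ∀ s ∈ range d, (k :: l).getD (s+1) 0 ≤ (k :: l₀).getD (s+1) 0 := by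
        intro s hs
        have hs := mem_range.mp hs
        have h3 := h2 (s+1) hs
        rw [heq (s+1) hs] at h3
        have h4 := f2 (s+1) hs
        rw [hget (s+1) hs]
        have : (((k :: l).getD (s+1) 0 : ℕ) : ℤ) ≤ (f (s+1) : ℤ) := by linarith
        exact_mod_cast this
      have hse : ∑ s ∈ range d, (k :: l).getD (s+1) 0 = ∑ s ∈ range d, (k :: l₀).getD (s+1) 0 := by
        apply le_antisymm (Finset.sum_le_sum hle)
        have e1 := list_sum_getD l k
        have e2 := list_sum_getD l₀ k
        rw [hlen] at e1; rw [hlen₀] at e2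
        rw [← e1, ← e2]; omega
      rw [Finset.sum_eq_sum_iff_of_le hle] at hse
      apply List.ext_getElem (by rw [hlen, hlen₀])
      intro s h5 h6
      have := hse s (mem_range.mpr (by omega))
      simpa [List.getD_eq_getElem?_getD, h5, h6] using this
    have hcne := coeff_ne_zero_of_chains hT0 hT d k l₀ hl₀ hlen₀ hother
    refine ⟨fun h => hcne (by rw [h, Polynomial.coeff_zero]), ?_⟩
    rw [← hsum₀]
    congr 1
    apply le_antisymm
    · rw [Polynomial.natDegree_le_iff_coeff_eq_zero]
      intro N hN
      apply coeff_zero_of_chains hT0 hT d k (l₀.sum + 1) _ N hN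
      intro l hl hlen
      by_cases h : l = l₀
      · rw [h]; omega
      · have := hother l hl hlen h; omega
    · exact Polynomial.le_natDegree_of_ne_zero hcne

theorem Dat.Chain.restrict {D : Dat m} {d c} (h : D.Chain (d+1) c) : D.Chain d c :=
  ⟨h.1, fun s hs => h.2.1 s (by omega), fun s hs => h.2.2 s (by omega)⟩

theorem main_concave {R : Type} [Field R] {B : ℕ → ℕ → R} {T : ℕ → ℕ → Polynomial R}
    (hT0 : ∀ n, T 0 n = 1)
    (hT : ∀ r n, T (r+1) n = ∑ i ∈ range n, Polynomial.C (B n i) * (Polynomial.X ^ i * T r i))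
    {p : ℕ} (k : ℕ) (hp : p.Prime)
    (hB : ∀ n i, i < n → (B n i ≠ 0 ↔ ¬ p ∣ n.choose i ∧ (p ^ m - 1) ∣ n - i)) (d : ℕ) :
    (T (d+1) k ≠ 0 → T d k ≠ 0) ∧ (T (d+2) k ≠ 0 →
      (T d k).natDegree + (T (d+2) k).natDegree < 2 * (T (d+1) k).natDegree) := by
  have hk : k < p ^ k := Nat.lt_pow_self hp.one_lt
  have key := main_deg (m := m) hT0 hT hp hk hB
  constructor
  · intro h
    obtain ⟨c, hc⟩ := (key (d+1)).1 h
    obtain ⟨u, hu⟩ := Dat.exists_greedy _ hc.restrict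
    exact ((key d).2 u hu).1
  · intro h
    obtain ⟨c, hc⟩ := (key (d+2)).1 h
    obtain ⟨u2, hu2⟩ := Dat.exists_greedy _ hc
    obtain ⟨u1, hu1⟩ := Dat.exists_greedy _ hc.restrict
    obtain ⟨u0, hu0⟩ := Dat.exists_greedy _ hc.restrict.restrict
    have h2 := ((key _).2 u2 hu2).2
    have h1 := ((key _).2 u1 hu1).2
    have h0 := ((key _).2 u0 hu0).2
    have := Dat.convex _ hu2 hu1 hu0
    zify
    rw [h0, h1, h2]
    push_cast
    linarith

end Transl2
end WPS

namespace WPS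
open Finset
section AbsVal

theorem AtoK_eq (Fq : Type) [Field Fq] (P : Polynomial Fq) :
    AtoK Fq P = ∑ i ∈ range (P.natDegree + 1), HahnSeries.single (-(i : ℤ)) (P.coeff i) := by
  rw [AtoK, Polynomial.coe_eval₂RingHom, Polynomial.eval₂_eq_sum_range]
  apply Finset.sum_congr rfl; intro i _
  have e : algebraMap Fq (Kinfty Fq) (P.coeff i) = HahnSeries.single 0 (P.coeff i) :=
    LaurentSeries.algebraMap_apply _ _
  rw [theta, HahnSeries.single_pow, e, HahnSeries.single_mul_single]
  simp

theorem AtoK_abs (Fq : Type) [Field Fq] [Fintype Fq] (P : Polynomial Fq) (hP : P ≠ 0) :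
    absKinfty Fq (AtoK Fq P) = (Fintype.card Fq : ℝ) ^ P.natDegree := by
  have hc : ∀ g : ℤ, (AtoK Fq P).coeff g =
      ∑ i ∈ range (P.natDegree + 1), if g = -(i : ℤ) then P.coeff i else 0 := by
    intro g
    rw [AtoK_eq, HahnSeries.coeff_sum]
    apply Finset.sum_congr rfl; intro i _
    rw [HahnSeries.coeff_single]
    congr
  have h1 : (AtoK Fq P).coeff (-(P.natDegree : ℤ)) ≠ 0 := by
    rw [hc, Finset.sum_eq_single P.natDegree]
    · rw [if_pos rfl]; exact Polynomial.leadingCoeff_ne_zero.mpr hP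
    · intro b _ hb; rw [if_neg (by omega)]
    · intro h; simp at h
  have h0 : AtoK Fq P ≠ 0 := by intro h; rw [h] at h1; simp at h1
  have h2 : (AtoK Fq P).order = -(P.natDegree : ℤ) := by
    apply le_antisymm (HahnSeries.order_le_of_coeff_ne_zero h1)
    by_contra hlt
    push Not at hlt
    apply h0
    rw [← HahnSeries.coeff_order_eq_zero, hc]
    apply Finset.sum_eq_zero; intro i hi
    have := mem_range.mp hi
    rw [if_neg (by omega)]
  rw [absKinfty, if_neg h0, h2, neg_neg, zpow_natCast]

theorem nonarch {F : Type*} [Field F] (v : AbsoluteValue F ℝ) (p : ℕ) (hp : p.Prime) [CharP F p]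
    (x y : F) : v (x + y) ≤ max (v x) (v y) := by
  have := Fact.mk hp
  set M := max (v x) (v y) with hM
  by_contra hlt
  push Not at hlt
  have hx : v x ≤ M := le_max_left _ _
  have hy : v y ≤ M := le_max_right _ _
  have hM0 : 0 ≤ M := (v.nonneg x).trans hx
  have hMpos : 0 < M := by
    rcases hM0.lt_or_eq with h | h
    · exact h
    · have h3 : v x = 0 := le_antisymm (h ▸ hx) (v.nonneg _)
      have h4 : v y = 0 := le_antisymm (h ▸ hy) (v.nonneg _)
      rw [v.eq_zero] at h3 h4
      rw [h3, h4, add_zero, map_zero, ← h] at hlt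
      exact absurd hlt (lt_irrefl _)
  have hr : 1 < v (x + y) / M := by rwa [one_lt_div hMpos]
  obtain ⟨n, hn⟩ := pow_unbounded_of_one_lt 2 hr
  have h1 : v (x + y) ^ (p ^ n) ≤ 2 * M ^ (p ^ n) := by
    rw [← map_pow, add_pow_char_pow]
    calc _ ≤ v (x ^ p ^ n) + v (y ^ p ^ n) := v.add_le _ _
      _ ≤ M ^ (p ^ n) + M ^ (p ^ n) := by
        rw [map_pow, map_pow]
        exact add_le_add (pow_le_pow_left₀ (v.nonneg _) hx _) (pow_le_pow_left₀ (v.nonneg _) hy _)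
      _ = _ := by ring
  have h2 : (v (x + y) / M) ^ (p ^ n) ≤ 2 := by
    rw [div_pow, div_le_iff₀ (by positivity)]; exact h1
  have h3 : (v (x + y) / M) ^ n ≤ (v (x + y) / M) ^ (p ^ n) :=
    pow_le_pow_right₀ hr.le (Nat.lt_pow_self hp.one_lt).le
  linarith

/-- maximal weight `M` attained first at `lo`, last at `hi` -/
structure Peak (W : ℕ → ℝ) (M : ℝ) (lo hi : ℕ) : Prop where
  le : ∀ n, W n ≤ M
  atlo : W lo = M
  athi : W hi = M
  below : ∀ n, n < lo → W n < M
  above : ∀ n, hi < n → W n < M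

theorem Peak.le_hi {W M lo hi} (h : Peak W M lo hi) : lo ≤ hi := by
  by_contra hlt
  have := h.above lo (by omega)
  rw [h.atlo] at this; exact lt_irrefl _ this

variable {F : Type*} [Field F] (v : AbsoluteValue F ℝ)

def wt (ρ : ℝ) (g : Polynomial F) (n : ℕ) : ℝ := v (g.coeff n) * ρ ^ n

theorem exists_peak {ρ : ℝ} (hρ : 0 < ρ) {g : Polynomial F} (hg : g ≠ 0) :
    ∃ M lo hi, 0 < M ∧ Peak (wt v ρ g) M lo hi := by
  classical
  obtain ⟨i, hi, hmax⟩ := Finset.exists_max_image g.support (wt v ρ g)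
    (Polynomial.support_nonempty.mpr hg)
  have hMpos : 0 < wt v ρ g i := by
    have : g.coeff i ≠ 0 := Polynomial.mem_support_iff.mp hi
    exact mul_pos (v.pos this) (pow_pos hρ _)
  have hz : ∀ n, n ∉ g.support → wt v ρ g n = 0 := by
    intro n hn
    rw [Polynomial.mem_support_iff, not_not] at hn
    simp [wt, hn]
  have hle : ∀ n, wt v ρ g n ≤ wt v ρ g i := by
    intro n
    by_cases h : n ∈ g.support
    · exact hmax n h
    · rw [hz n h]; exact hMpos.le
  let S := g.support.filter (fun n => wt v ρ g n = wt v ρ g i)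
  have hS : S.Nonempty := ⟨i, by rw [mem_filter]; exact ⟨hi, rfl⟩⟩
  have hmem : ∀ n, wt v ρ g n = wt v ρ g i → n ∈ S := by
    intro n hn
    simp only [S, mem_filter]
    refine ⟨?_, hn⟩
    by_contra h
    rw [hz n h] at hn; linarith
  refine ⟨wt v ρ g i, S.min' hS, S.max' hS, hMpos, hle, ?_, ?_, ?_, ?_⟩
  · exact (mem_filter.mp (S.min'_mem hS)).2
  · exact (mem_filter.mp (S.max'_mem hS)).2
  · intro n hn
    refine lt_of_le_of_ne (hle n) (fun h => ?_)
    have := S.min'_le n (hmem n h); omega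
  · intro n hn
    refine lt_of_le_of_ne (hle n) (fun h => ?_)
    have := S.le_max' n (hmem n h); omega

theorem peak_mul (hna : ∀ x y, v (x + y) ≤ max (v x) (v y)) {ρ : ℝ} (hρ : 0 < ρ) {α : F} (hα : v α = ρ)
    {g : Polynomial F} {M : ℝ} (hM : 0 < M) {lo hi : ℕ} (h : Peak (wt v ρ g) M lo hi) :
    Peak (wt v ρ ((Polynomial.X - Polynomial.C α) * g)) (ρ * M) lo (hi + 1) := by
  have hsub : ∀ x y, v (x - y) ≤ max (v x) (v y) := by
    intro x y
    have := hna x (-y)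
    rwa [v.map_neg, ← sub_eq_add_neg] at this
  have c0 : ((Polynomial.X - Polynomial.C α) * g).coeff 0 = -(α * g.coeff 0) := by
    simp [sub_mul]
  have cs : ∀ n, ((Polynomial.X - Polynomial.C α) * g).coeff (n+1) = g.coeff n - α * g.coeff (n+1) := by
    intro n; simp [sub_mul]
  have w0 : wt v ρ ((Polynomial.X - Polynomial.C α) * g) 0 = ρ * wt v ρ g 0 := by
    simp only [wt, c0, v.map_neg, v.map_mul, hα]; ring
  have ea : ∀ n, v (g.coeff n) * ρ ^ (n+1) = ρ * wt v ρ g n := by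
    intro n; simp only [wt]; ring
  have eb : ∀ n, v (α * g.coeff (n+1)) * ρ ^ (n+1) = ρ * wt v ρ g (n+1) := by
    intro n; simp only [wt, v.map_mul, hα]; ring
  have ws : ∀ n, wt v ρ ((Polynomial.X - Polynomial.C α) * g) (n+1) ≤
      max (ρ * wt v ρ g n) (ρ * wt v ρ g (n+1)) := by
    intro n
    rw [← ea, ← eb, ← max_mul_of_nonneg _ _ (by positivity), wt, cs]
    exact mul_le_mul_of_nonneg_right (hsub _ _) (by positivity)
  have wa : ∀ n, ρ * wt v ρ g n ≤
      max (wt v ρ ((Polynomial.X - Polynomial.C α) * g) (n+1)) (ρ * wt v ρ g (n+1)) := by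
    intro n
    rw [← ea, ← eb, wt, cs, ← max_mul_of_nonneg _ _ (by positivity)]
    apply mul_le_mul_of_nonneg_right _ (by positivity)
    have := hna (g.coeff n - α * g.coeff (n+1)) (α * g.coeff (n+1))
    simpa using this
  have wb : ∀ n, ρ * wt v ρ g (n+1) ≤
      max (wt v ρ ((Polynomial.X - Polynomial.C α) * g) (n+1)) (ρ * wt v ρ g n) := by
    intro n
    rw [← eb n, ← ea n, wt, cs, ← max_mul_of_nonneg _ _ (by positivity)]
    apply mul_le_mul_of_nonneg_right _ (by positivity)
    have := hsub (g.coeff n) (g.coeff n - α * g.coeff (n+1))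
    rw [max_comm]
    simpa using this
  have hle : ∀ n, wt v ρ ((Polynomial.X - Polynomial.C α) * g) n ≤ ρ * M := by
    intro n
    match n with
    | 0 => rw [w0]; exact mul_le_mul_of_nonneg_left (h.le 0) hρ.le
    | n+1 =>
      exact (ws n).trans (max_le (mul_le_mul_of_nonneg_left (h.le _) hρ.le)
        (mul_le_mul_of_nonneg_left (h.le _) hρ.le))
  refine ⟨hle, ?_, ?_, ?_, ?_⟩
  · match lo, h with
    | 0, h => rw [w0, h.atlo]
    | n+1, h =>
      apply le_antisymm (hle _)
      have h1 := wb n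
      rw [h.atlo] at h1
      rcases le_max_iff.mp h1 with h2 | h2
      · exact h2
      · have := mul_lt_mul_of_pos_left (h.below n (by omega)) hρ
        linarith
  · apply le_antisymm (hle _)
    have h1 := wa hi
    rw [h.athi] at h1
    rcases le_max_iff.mp h1 with h2 | h2
    · exact h2
    · have := mul_lt_mul_of_pos_left (h.above (hi+1) (by omega)) hρ
      linarith
  · intro n hn
    match n with
    | 0 => rw [w0]; exact mul_lt_mul_of_pos_left (h.below 0 hn) hρ
    | n+1 =>
      exact (ws n).trans_lt (max_lt (mul_lt_mul_of_pos_left (h.below _ (by omega)) hρ)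
        (mul_lt_mul_of_pos_left (h.below _ hn) hρ))
  · intro n hn
    match n with
    | 0 => omega
    | n+1 =>
      exact (ws n).trans_lt (max_lt (mul_lt_mul_of_pos_left (h.above _ (by omega)) hρ)
        (mul_lt_mul_of_pos_left (h.above _ (by omega)) hρ))

theorem newton (hna : ∀ x y, v (x + y) ≤ max (v x) (v y)) {f : Polynomial F}
    (hf0 : f.coeff 0 ≠ 0)
    (hf1 : ∀ d, f.coeff (d+1) ≠ 0 → f.coeff d ≠ 0)
    (hf2 : ∀ d, f.coeff (d+2) ≠ 0 → v (f.coeff d) * v (f.coeff (d+2)) < v (f.coeff (d+1)) ^ 2)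
    {α β : F} (hαβ : v α = v β) {h : Polynomial F}
    (hf : f = (Polynomial.X - Polynomial.C α) * ((Polynomial.X - Polynomial.C β) * h)) : False := by
  have hh : h ≠ 0 := by rintro rfl; simp at hf; rw [hf] at hf0; simp at hf0
  have hα : α ≠ 0 := by rintro rfl; apply hf0; rw [hf]; simp
  have hρ : 0 < v α := v.pos hα
  obtain ⟨M, lo, hi, hM, hp⟩ := exists_peak v hρ hh
  have h1 := peak_mul v hna hρ hαβ.symm hM hp
  have h2 := peak_mul v hna hρ rfl (by positivity) h1
  rw [← hf] at h2
  have hlohi := hp.le_hi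
  set N := v α * (v α * M) with hN
  have hNpos : 0 < N := by positivity
  have hne : f.coeff (hi+2) ≠ 0 := by
    intro h0
    have := h2.athi
    simp only [wt] at this
    rw [h0] at this; simp at this; exact hNpos.ne this
  have hall : ∀ e n, n + e = hi + 2 → f.coeff n ≠ 0 := by
    intro e
    induction e with
    | zero => intro n hn; rw [show n = hi + 2 by omega]; exact hne
    | succ e ih => intro n hn; exact hf1 n (ih (n+1) (by omega))
  have hwpos : ∀ n, n ≤ hi + 2 → 0 < wt v (v α) f n := fun n hn =>
    mul_pos (v.pos (hall (hi + 2 - n) n (by omega))) (pow_pos hρ _)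
  have hstep : ∀ n, n + 2 ≤ hi + 2 → wt v (v α) f (n+1) ≤ wt v (v α) f n →
      wt v (v α) f (n+2) < wt v (v α) f (n+1) := by
    intro n hn hle
    have h3 := hf2 n (hall (hi + 2 - (n+2)) _ (by omega))
    have h4 : wt v (v α) f n * wt v (v α) f (n+2) < wt v (v α) f (n+1) ^ 2 := by
      have : wt v (v α) f n * wt v (v α) f (n+2) =
          (v (f.coeff n) * v (f.coeff (n+2))) * v α ^ (2*n+2) := by simp only [wt]; ring
      rw [this]
      have : wt v (v α) f (n+1) ^ 2 = v (f.coeff (n+1)) ^ 2 * v α ^ (2*n+2) := by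
        simp only [wt]; ring
      rw [this]
      exact mul_lt_mul_of_pos_right h3 (by positivity)
    have h5 := hwpos n (by omega)
    have h6 := hwpos (n+1) (by omega)
    by_contra h7
    push Not at h7
    nlinarith
  have hdec : ∀ i, lo + i + 2 ≤ hi + 2 → wt v (v α) f (lo + i + 2) < wt v (v α) f (lo + i + 1) ∧
      wt v (v α) f (lo + i + 1) ≤ N := by
    intro i
    induction i with
    | zero =>
      intro h3
      exact ⟨hstep lo (by omega) (by rw [h2.atlo]; exact h2.le _), h2.le _⟩
    | succ i ih =>
      intro h3
      have := (ih (by omega)).1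
      exact ⟨hstep (lo + i + 1) (by omega) this.le, h2.le _⟩
  have h8 := hdec (hi - lo) (by omega)
  have e : lo + (hi - lo) + 2 = hi + 1 + 1 := by omega
  rw [e, h2.athi] at h8
  linarith [h8.1, h8.2]

end AbsVal
end WPS

namespace WPS
section Fin

theorem charP_of_card (R : Type) [Field R] [Fintype R] {p m : ℕ} (hp : p.Prime) (hm : 0 < m)
    (h : Fintype.card R = p ^ m) : CharP R p := by
  obtain ⟨r, hr⟩ := CharP.exists R
  obtain ⟨n, hr', hn⟩ := FiniteField.card R r
  rw [h] at hn
  have h1 : p ∣ r ^ (n : ℕ) := by rw [← hn]; exact dvd_pow_self p hm.ne'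
  have h2 := hp.dvd_of_dvd_pow h1
  rw [Nat.prime_dvd_prime_iff_eq hp hr'] at h2
  rw [h2]; exact hr

theorem conc (R : Type) [Field R] [Fintype R] {p m : ℕ} (hp : p.Prime) (hm : 0 < m)
    (h : Fintype.card R = p ^ m) (k d : ℕ) :
    (powerSum R (d+1) k ≠ 0 → powerSum R d k ≠ 0) ∧ (powerSum R (d+2) k ≠ 0 →
      (powerSum R d k).natDegree + (powerSum R (d+2) k).natDegree <
        2 * (powerSum R (d+1) k).natDegree) := by
  have := charP_of_card R hp hm h
  have : NeZero m := ⟨hm.ne'⟩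
  apply main_concave (m := m) (B := Bc R) (T := powerSum R) (powerSum_zero R) (powerSum_succ R) k hp
  intro n i hi
  rw [← h]
  exact Bc_ne_zero R p n i hi

end Fin
end WPS

/-- Riemann Hypothesis of Wan–Poonen–Sheats, polynomial case: for `k ≥ 1`, in an algebraic
closure of `K` equipped with (the unique) absolute value extending the ∞-adic absolute
value of `K`, any two roots of the zeta polynomial `Z_k(X) = Σ_d S_d(k) X^d` having the
same absolute value are equal, and every root of `Z_k` is simple. -/
theorem wan_poonen_sheats_RH
    (p m₀ : ℕ) (hp : p.Prime) (hm₀ : 0 < m₀)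
    (Fq : Type) [Field Fq] [Fintype Fq] (q : ℕ) (hq : q = p ^ m₀)
    (hcard : Fintype.card Fq = q)
    (k : ℕ) (hk : 0 < k)
    (Zk : Polynomial (Kinfty Fq))
    (hZk : ∀ d : ℕ, Zk.coeff d = AtoK Fq (powerSum Fq d k))
    (absv : AbsoluteValue (AlgebraicClosure (Kinfty Fq)) ℝ)
    (habsv : ∀ x : Kinfty Fq,
      absv (algebraMap (Kinfty Fq) (AlgebraicClosure (Kinfty Fq)) x) = absKinfty Fq x) :
    (∀ α β : AlgebraicClosure (Kinfty Fq),
        (Zk.map (algebraMap (Kinfty Fq) (AlgebraicClosure (Kinfty Fq)))).IsRoot α →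
        (Zk.map (algebraMap (Kinfty Fq) (AlgebraicClosure (Kinfty Fq)))).IsRoot β →
        absv α = absv β → α = β) ∧
    (∀ α : AlgebraicClosure (Kinfty Fq),
        (Zk.map (algebraMap (Kinfty Fq) (AlgebraicClosure (Kinfty Fq)))).IsRoot α →
        (Zk.map (algebraMap (Kinfty Fq) (AlgebraicClosure (Kinfty Fq)))).rootMultiplicity α
          = 1) := by
  have hZ1 : ∀ d, powerSum Fq (d+1) k ≠ 0 → powerSum Fq d k ≠ 0 := by
    intro d; exact (WPS.conc Fq hp hm₀ (hcard.trans hq) k d).1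
  have hZ2 := fun d => (WPS.conc Fq hp hm₀ (hcard.trans hq) k d).2
  set F := AlgebraicClosure (Kinfty Fq) with hF
  set φ := algebraMap (Kinfty Fq) F with hφ
  have hcharFq : CharP Fq p := WPS.charP_of_card Fq hp hm₀ (hcard.trans hq)
  have hcharK : CharP (Kinfty Fq) p :=
    charP_of_injective_ringHom (algebraMap Fq (Kinfty Fq)).injective p
  have hcharF : CharP F p := charP_of_injective_ringHom φ.injective p
  have hna := WPS.nonarch absv p hp
  have hq1 : (1 : ℝ) < (Fintype.card Fq : ℝ) := by exact_mod_cast Fintype.one_lt_card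
  have hcoef : ∀ d, (Zk.map φ).coeff d = φ (AtoK Fq (powerSum Fq d k)) := by
    intro d; rw [Polynomial.coeff_map, hZk]
  have hval : ∀ d, powerSum Fq d k ≠ 0 →
      absv ((Zk.map φ).coeff d) = (Fintype.card Fq : ℝ) ^ (powerSum Fq d k).natDegree := by
    intro d hd
    rw [hcoef, habsv, WPS.AtoK_abs Fq _ hd]
  have hne : ∀ d, (Zk.map φ).coeff d ≠ 0 ↔ powerSum Fq d k ≠ 0 := by
    intro d
    constructor
    · intro h h0
      apply h; rw [hcoef, h0, map_zero, map_zero]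
    · intro h h0
      have := hval d h
      rw [h0, map_zero] at this
      have h2 : (0 : ℝ) < (Fintype.card Fq : ℝ) ^ (powerSum Fq d k).natDegree := by positivity
      linarith
  have key := fun (α β : F) (h : absv α = absv β) (g : Polynomial F) =>
    WPS.newton absv hna (f := Zk.map φ) (α := α) (β := β) (h := g)
    (by rw [hne, WPS.powerSum_zero]; exact one_ne_zero)
    (fun d h => by rw [hne] at h ⊢; exact hZ1 d h)
    (fun d h => by
      rw [hne] at h
      have h1 := hZ1 _ h
      have h0 := hZ1 _ h1
      rw [hval _ h, hval _ h1, hval _ h0, ← pow_add, ← pow_mul]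
      apply pow_lt_pow_right₀ hq1
      have := hZ2 d h
      omega) h
  have hfne : Zk.map φ ≠ 0 := by
    intro h
    have := (hne 0).mpr (by rw [WPS.powerSum_zero]; exact one_ne_zero)
    rw [h] at this; simp at this
  constructor
  · intro α β hα hβ hab
    by_contra hne'
    obtain ⟨g, hg⟩ := Polynomial.dvd_iff_isRoot.mpr hα
    have hgβ : g.IsRoot β := by
      rw [hg, Polynomial.IsRoot, Polynomial.eval_mul, mul_eq_zero] at hβ
      rcases hβ with h | h
      · simp [sub_eq_zero] at h; exact absurd h.symm hne'
      · exact h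
    obtain ⟨h, hh⟩ := Polynomial.dvd_iff_isRoot.mpr hgβ
    exact key α β hab h (by rw [hg, hh])
  · intro α hα
    have h1 : 0 < (Zk.map φ).rootMultiplicity α := (Polynomial.rootMultiplicity_pos hfne).mpr hα
    by_contra hne'
    have h2 : 2 ≤ (Zk.map φ).rootMultiplicity α := by omega
    rw [Polynomial.le_rootMultiplicity_iff hfne] at h2
    obtain ⟨h, hh⟩ := h2
    exact key α α rfl h (by rw [hh]; ring)
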